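/- arXiv:1306.4104 — 7 statements merged into one kernel-verified Lean document; each statement's English description precedes it below -/
import Mathlib

section
/- Let n ≥ 1 be an odd integer and let p be an odd prime. If r is an integer with r > log_p n + 1 (equivalently p^{r-1} > n), then S_n(p^r) = 0. -/
open Finset

/-- The Kloosterman sum `K(u,v;q) = ∑_{x ∈ (ℤ/qℤ)^*} e^{2πi(ux + v x̄)/q}`. -/
noncomputable def Kl (q : ℕ) (u v : ℤ) : ℂ :=
  ∑ x ∈ Finset.range q,
    if Nat.Coprime x q then
      Complex.exp (2 * Real.pi * Complex.I *
        ((u : ℂ) * (x : ℂ) + (v : ℂ) * ((((x : ZMod q)⁻¹ : ZMod q).val : ℕ) : ℂ)) / (q : ℂ))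
    else 0

/-- The `n`-th power moment `S_n(q) = ∑_{u=1}^q K(u,1;q)^n`. -/
noncomputable def S (n q : ℕ) : ℂ :=
  ∑ u ∈ Finset.range q, Kl q ((u : ℤ) + 1) 1 ^ n

namespace KloostermanMoment

open ZMod

section General

variable {N : ℕ} [NeZero N]

/-- The Kloosterman sum `K(u,1;N)` as a sum over the unit group of `ZMod N`. -/
noncomputable def unitSum (u : ZMod N) : ℂ :=
  ∑ x : (ZMod N)ˣ, stdAddChar (u * x + (x⁻¹ : (ZMod N)ˣ) : ZMod N)

lemma sum_range_eq_sum_zmod (f : ZMod N → ℂ) :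
    ∑ x ∈ range N, f (x : ZMod N) = ∑ x : ZMod N, f x := by
  refine sum_bij' (fun x _ => (x : ZMod N)) (fun x _ => x.val) (by simp)
    (fun x _ => mem_range.2 (ZMod.val_lt x)) ?_ (by simp) (by simp)
  intro x hx
  exact ZMod.val_cast_of_lt (mem_range.1 hx)

lemma sum_units_eq_sum_ite (f : ZMod N → ℂ) :
    ∑ x : (ZMod N)ˣ, f x = ∑ x : ZMod N, if IsUnit x then f x else 0 := by
  classical
  rw [← sum_filter]
  refine sum_bij (fun x _ => (x : ZMod N)) (by simp) (fun x _ y _ h => Units.ext h) ?_ (by simp)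
  intro b hb
  obtain ⟨y, rfl⟩ := (mem_filter.1 hb).2
  exact ⟨y, mem_univ _, rfl⟩

lemma Kl_eq_unitSum (u : ℤ) : Kl N u 1 = unitSum (u : ZMod N) := by
  have h : unitSum (u : ZMod N) =
      ∑ x : (ZMod N)ˣ, (fun x : ZMod N => stdAddChar ((u : ZMod N) * x + x⁻¹)) x := by
    simp [unitSum]
  rw [h, sum_units_eq_sum_ite (fun x : ZMod N => stdAddChar ((u : ZMod N) * x + x⁻¹)),
    ← sum_range_eq_sum_zmod, Kl]
  refine sum_congr rfl fun x _ => ?_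
  simp only [ZMod.isUnit_iff_coprime]
  split_ifs
  · have : (u : ZMod N) * (x : ZMod N) + (x : ZMod N)⁻¹ =
        ((u * x + ((x : ZMod N)⁻¹).val : ℤ) : ZMod N) := by
      push_cast
      rw [ZMod.natCast_zmod_val]
    rw [this, stdAddChar_coe]
    push_cast
    rw [one_mul]
  · rfl

lemma S_eq_sum_unitSum (n : ℕ) : S n N = ∑ u : ZMod N, unitSum u ^ n := by
  have h := sum_range_eq_sum_zmod (fun u : ZMod N => unitSum (u + 1) ^ n)
  have h' := Equiv.sum_comp (Equiv.addRight (1 : ZMod N)) (fun u => unitSum u ^ n)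
  rw [S, ← h.trans h']
  refine sum_congr rfl fun u _ => ?_
  rw [Kl_eq_unitSum]
  push_cast
  rfl

/-- Stationary phase: only the near-critical points of the phase `u x + x⁻¹` contribute. -/
lemma unitSum_eq_stationary {c : ZMod N} (hc : c * c = 0) (u : ZMod N) :
    unitSum u = ∑ x : (ZMod N)ˣ,
      if c * (u * x - (x⁻¹ : (ZMod N)ˣ)) = 0 then
        (stdAddChar (u * x + (x⁻¹ : (ZMod N)ˣ) : ZMod N) : ℂ) else 0 := by
  have hN : (N : ℂ) ≠ 0 := Nat.cast_ne_zero.2 (NeZero.ne N)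
  let e : ZMod N → (ZMod N)ˣ := fun t =>
    ⟨1 + c * t, 1 - c * t, by linear_combination (-t * t) * hc,
      by linear_combination (-t * t) * hc⟩
  have shift : ∀ t : ZMod N, unitSum u = ∑ x : (ZMod N)ˣ,
      stdAddChar (u * x + (x⁻¹ : (ZMod N)ˣ) : ZMod N) *
        stdAddChar (t * (c * (u * x - (x⁻¹ : (ZMod N)ˣ))) : ZMod N) := by
    intro t
    rw [unitSum, ← Equiv.sum_comp (Equiv.mulRight (e t))]
    refine sum_congr rfl fun x _ => ?_
    rw [← AddChar.map_add_eq_mul]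
    congr 1
    have h₁ : ((e t : (ZMod N)ˣ) : ZMod N) = 1 + c * t := rfl
    have h₂ : (((e t)⁻¹ : (ZMod N)ˣ) : ZMod N) = 1 - c * t := rfl
    simp only [Equiv.coe_mulRight, mul_inv, Units.val_mul, h₁, h₂]
    ring
  apply mul_left_cancel₀ hN
  calc (N : ℂ) * unitSum u = ∑ t : ZMod N, unitSum u := by simp [ZMod.card]
    _ = ∑ x : (ZMod N)ˣ, ∑ t : ZMod N, stdAddChar (u * x + (x⁻¹ : (ZMod N)ˣ) : ZMod N) *
        stdAddChar (t * (c * (u * x - (x⁻¹ : (ZMod N)ˣ))) : ZMod N) := by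
      rw [sum_comm]
      exact sum_congr rfl fun t _ => shift t
    _ = _ := by
      rw [mul_sum]
      refine sum_congr rfl fun x _ => ?_
      rw [← mul_sum, AddChar.sum_mulShift _ (isPrimitive_stdAddChar N), ZMod.card]
      split_ifs <;> simp [mul_comm]

/-- The contribution to `K(w²,1;N)` of the critical point `w⁻¹`. -/
noncomputable def localSum (c w : ZMod N) : ℂ :=
  ∑ y : (ZMod N)ˣ,
    if c * (y - 1) = 0 then (stdAddChar (w * (y + (y⁻¹ : (ZMod N)ˣ)) : ZMod N) : ℂ) else 0

lemma localSum_add {c d : ZMod N}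
    (hcd : ∀ y : ZMod N, c * (y - 1) = 0 → d * (y - 1) ^ 2 = 0) (w : ZMod N) :
    localSum c (w + d) = stdAddChar (2 * d) * localSum c w := by
  rw [localSum, localSum, mul_sum]
  refine sum_congr rfl fun y _ => ?_
  split_ifs with hy
  · rw [← AddChar.map_add_eq_mul]
    congr 1
    have h := hcd y hy
    have hy' : (y : ZMod N) * (y⁻¹ : (ZMod N)ˣ) = 1 := y.mul_inv
    linear_combination ((y⁻¹ : (ZMod N)ˣ) : ZMod N) * h - (d * y - 2 * d) * hy'
  · simp

lemma unitSum_sq [IsLocalRing (ZMod N)] (h₂ : IsUnit (2 : ZMod N)) {c : ZMod N}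
    (hc : c * c = 0) (hc₀ : c ≠ 0) (w : (ZMod N)ˣ) :
    unitSum ((w : ZMod N) ^ 2) = localSum c w + localSum c (-w) := by
  have hneg : localSum c (-w) = ∑ y : (ZMod N)ˣ,
      if c * (y + 1) = 0 then (stdAddChar (w * (y + (y⁻¹ : (ZMod N)ˣ)) : ZMod N) : ℂ)
      else 0 := by
    rw [localSum, ← Equiv.sum_comp (Equiv.neg (ZMod N)ˣ)]
    refine sum_congr rfl fun y _ => ?_
    have h : c * (((-y : (ZMod N)ˣ) : ZMod N) - 1) = 0 ↔ c * ((y : ZMod N) + 1) = 0 := by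
      rw [← neg_eq_zero, Units.val_neg]
      ring_nf
    have h' : -(w : ZMod N) * (-y + -(y⁻¹ : (ZMod N)ˣ)) = w * (y + (y⁻¹ : (ZMod N)ˣ)) := by ring
    simp only [Equiv.neg_apply, h, inv_neg]
    simp only [Units.val_neg, h']
  rw [unitSum_eq_stationary hc, ← Equiv.sum_comp (Equiv.mulLeft w⁻¹), hneg, localSum,
    ← sum_add_distrib]
  refine sum_congr rfl fun y _ => ?_
  have hw : (w : ZMod N) * (w⁻¹ : (ZMod N)ˣ) = 1 := w.mul_inv
  have hy : (y : ZMod N) * (y⁻¹ : (ZMod N)ˣ) = 1 := y.mul_inv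
  simp only [Equiv.coe_mulLeft, mul_inv, inv_inv, Units.val_mul]
  have hphase : (w : ZMod N) ^ 2 * ((w⁻¹ : (ZMod N)ˣ) * y) + w * (y⁻¹ : (ZMod N)ˣ) =
      w * (y + (y⁻¹ : (ZMod N)ˣ)) := by
    linear_combination (w * y : ZMod N) * hw
  have hcond : c * ((w : ZMod N) ^ 2 * ((w⁻¹ : (ZMod N)ˣ) * y) - w * (y⁻¹ : (ZMod N)ˣ)) = 0 ↔
      c * ((y - 1) * (y + 1)) = 0 := by
    have h : c * ((w : ZMod N) ^ 2 * ((w⁻¹ : (ZMod N)ˣ) * y) - w * (y⁻¹ : (ZMod N)ˣ)) =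
        ((w * y⁻¹ : (ZMod N)ˣ) : ZMod N) * (c * ((y - 1) * (y + 1))) := by
      rw [Units.val_mul]
      linear_combination (c * w * y : ZMod N) * hw - (c * w * y : ZMod N) * hy
    rw [h, Units.mul_right_eq_zero]
  rw [hphase]
  simp only [hcond]
  have hexcl : ¬ (c * ((y : ZMod N) - 1) = 0 ∧ c * ((y : ZMod N) + 1) = 0) := by
    rintro ⟨h, h'⟩
    refine hc₀ ((h₂.mul_left_eq_zero).1 ?_)
    linear_combination h' - h
  have hor : c * ((y - 1) * (y + 1)) = 0 ↔
      c * ((y : ZMod N) - 1) = 0 ∨ c * ((y : ZMod N) + 1) = 0 := by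
    constructor
    · intro h
      have : IsUnit (((y : ZMod N) + 1) + (-((y : ZMod N) - 1))) := by
        convert h₂ using 1
        ring
      rcases IsLocalRing.isUnit_or_isUnit_of_isUnit_add this with h' | h'
      · left
        rw [← mul_assoc] at h
        exact (h'.mul_left_eq_zero).1 h
      · right
        rw [IsUnit.neg_iff] at h'
        refine (h'.mul_left_eq_zero).1 ?_
        linear_combination h
    · rintro (h | h)
      · linear_combination ((y : ZMod N) + 1) * h
      · linear_combination ((y : ZMod N) - 1) * h
  simp only [hor]
  by_cases h : c * ((y : ZMod N) - 1) = 0 <;> by_cases h' : c * ((y : ZMod N) + 1) = 0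
  · exact absurd ⟨h, h'⟩ hexcl
  all_goals simp [h, h']

lemma sum_units_eq_zero_of_shift {d : ZMod N} (hd : IsNilpotent d) {f : ZMod N → ℂ} {a : ℂ}
    (ha : a ≠ 1) (hf : ∀ w, f (w + d) = a * f w) : ∑ w : (ZMod N)ˣ, f w = 0 := by
  have hu : ∀ w : ZMod N, IsUnit (w + d) ↔ IsUnit w := fun w =>
    ⟨fun h => by simpa using hd.neg.isUnit_add_left_of_commute h (Commute.all _ _),
      fun h => hd.isUnit_add_left_of_commute h (Commute.all _ _)⟩
  have h : ∑ w : (ZMod N)ˣ, f w = a * ∑ w : (ZMod N)ˣ, f w := by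
    rw [sum_units_eq_sum_ite, mul_sum]
    rw [← Equiv.sum_comp (Equiv.addRight d)]
    refine sum_congr rfl fun w _ => ?_
    simp [hu, hf]
  have h' : (1 - a) * ∑ w : (ZMod N)ˣ, f w = 0 := by linear_combination h
  exact (mul_eq_zero.1 h').resolve_left (sub_ne_zero.2 ha.symm)

/-- Summing over units a function supported on squares of units can be done over square roots. -/
lemma sum_eq_zero_of_sum_sq_eq_zero {f : ZMod N → ℂ}
    (hsupp : ∀ u, f u ≠ 0 → ∃ w : (ZMod N)ˣ, (w : ZMod N) ^ 2 = u)
    (h : ∑ w : (ZMod N)ˣ, f ((w : ZMod N) ^ 2) = 0) : ∑ u, f u = 0 := by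
  classical
  let k : ℕ := #{w : (ZMod N)ˣ | (w : ZMod N) ^ 2 = 1}
  have hk : (k : ℂ) ≠ 0 := by
    refine Nat.cast_ne_zero.2 (card_ne_zero.2 ⟨1, ?_⟩)
    simp
  have hfib : ∀ w₀ : (ZMod N)ˣ,
      #{w : (ZMod N)ˣ | (w : ZMod N) ^ 2 = (w₀ : ZMod N) ^ 2} = k := by
    intro w₀
    refine card_equiv (Equiv.mulRight w₀⁻¹) fun w => ?_
    simp only [mem_filter, mem_univ, true_and, Equiv.coe_mulRight]
    rw [← Units.val_pow_eq_pow_val, ← Units.val_pow_eq_pow_val, ← Units.val_pow_eq_pow_val,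
      Units.val_inj, Units.val_eq_one, mul_pow, inv_pow, mul_inv_eq_one]
  refine (mul_eq_zero.1 ?_).resolve_left hk
  rw [← h, mul_sum, ← sum_fiberwise univ (fun w : (ZMod N)ˣ => (w : ZMod N) ^ 2)]
  refine sum_congr rfl fun u _ => ?_
  rw [sum_congr rfl (g := fun _ => f u) (fun w hw => by rw [(mem_filter.1 hw).2]), sum_const,
    nsmul_eq_mul]
  by_cases hu : f u = 0
  · simp [hu]
  · obtain ⟨w₀, rfl⟩ := hsupp u hu
    rw [hfib]

end General

section PrimePower

variable {p r : ℕ}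

lemma pow_sub_dvd_of_pow_mul_eq_zero (hp : p.Prime) {m : ℕ} (hm : m ≤ r) {a : ZMod (p ^ r)}
    (h : (p : ZMod (p ^ r)) ^ m * a = 0) : (p : ZMod (p ^ r)) ^ (r - m) ∣ a := by
  have : NeZero (p ^ r) := ⟨pow_ne_zero _ hp.ne_zero⟩
  rw [← ZMod.natCast_zmod_val a] at h ⊢
  rw [← Nat.cast_pow, ← Nat.cast_mul, ZMod.natCast_eq_zero_iff] at h
  rw [← Nat.cast_pow]
  refine Nat.cast_dvd_cast (Nat.dvd_of_mul_dvd_mul_left (pow_pos hp.pos m) ?_)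
  rwa [← pow_add, Nat.add_sub_cancel' hm]

lemma natCast_pow_eq_zero {k : ℕ} (hk : r ≤ k) : (p : ZMod (p ^ r)) ^ k = 0 := by
  rw [← Nat.cast_pow, ZMod.natCast_eq_zero_iff]
  exact pow_dvd_pow p hk

lemma natCast_pow_ne_zero (hp : p.Prime) {k : ℕ} (hk : k < r) : (p : ZMod (p ^ r)) ^ k ≠ 0 := by
  rw [← Nat.cast_pow, Ne, ZMod.natCast_eq_zero_iff, Nat.pow_dvd_pow_iff_le_right hp.one_lt]
  exact hk.not_ge

lemma isLocalRing_zmod_prime_pow (hp : p.Prime) (hr : 0 < r) : IsLocalRing (ZMod (p ^ r)) := by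
  have : NeZero (p ^ r) := ⟨pow_ne_zero _ hp.ne_zero⟩
  have : Fact (1 < p ^ r) := ⟨Nat.one_lt_pow hr.ne' hp.one_lt⟩
  refine IsLocalRing.of_nonunits_add fun a b ha hb => ?_
  rw [mem_nonunits_iff, ← ZMod.natCast_zmod_val a,
    ZMod.isUnit_natCast_iff_not_dvd_pow hp hr, not_not] at ha
  rw [mem_nonunits_iff, ← ZMod.natCast_zmod_val b,
    ZMod.isUnit_natCast_iff_not_dvd_pow hp hr, not_not] at hb
  rw [mem_nonunits_iff, ← ZMod.natCast_zmod_val a, ← ZMod.natCast_zmod_val b, ← Nat.cast_add,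
    ZMod.isUnit_natCast_iff_not_dvd_pow hp hr, not_not]
  exact dvd_add ha hb

/-- A residue congruent to `1` modulo the odd prime `p` is a square modulo `p ^ r`. -/
lemma exists_sq_eq_of_dvd_sub_one (hp : p.Prime) (hp₂ : p ≠ 2) {a : ZMod (p ^ r)}
    (ha : (p : ZMod (p ^ r)) ∣ a - 1) : ∃ b, b ^ 2 = a := by
  have h := dvd_sub_pow_of_dvd_sub ha r
  rw [natCast_pow_eq_zero r.le_succ, zero_dvd_iff, one_pow, sub_eq_zero] at h
  obtain ⟨k, hk⟩ := ((hp.odd_of_ne_two hp₂).pow (n := r)).add_one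
  refine ⟨a ^ k, ?_⟩
  rw [← pow_mul, mul_two, ← hk, pow_succ, h, one_mul]

end PrimePower

end KloostermanMoment

open KloostermanMoment in
/-- Let `n ≥ 1` be odd and `p` an odd prime. If `r > log_p n + 1`
(equivalently `p^(r-1) > n`), then `S_n(p^r) = 0`. -/
theorem odd_power_moment_vanishes (n p r : ℕ) (hn : 1 ≤ n) (hodd : Odd n)
    (hp : p.Prime) (hpodd : p ≠ 2) (hr : n < p ^ (r - 1)) :
    S n (p ^ r) = 0 := by
  have hr₂ : 2 ≤ r := by
    by_contra! h
    have : r - 1 = 0 := by omega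
    rw [this, pow_zero] at hr
    omega
  have : NeZero (p ^ r) := ⟨pow_ne_zero _ hp.ne_zero⟩
  have := isLocalRing_zmod_prime_pow hp (show 0 < r by omega)
  have h₂ : IsUnit (2 : ZMod (p ^ r)) := by
    have := ZMod.isUnit_natCast_iff_not_dvd_pow (a := 2) hp (show 0 < r by omega)
    rw [Nat.cast_two] at this
    rw [this, Nat.prime_dvd_prime_iff_eq hp Nat.prime_two]
    exact hpodd
  obtain ⟨m, hm⟩ : ∃ m, m = (r + 1) / 2 := ⟨_, rfl⟩
  set c : ZMod (p ^ r) := (p : ZMod (p ^ r)) ^ m with hc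
  have hcc : c * c = 0 := by
    rw [hc, ← pow_add]
    exact natCast_pow_eq_zero (by omega)
  have hc₀ : c ≠ 0 := natCast_pow_ne_zero hp (by omega)
  have hcd : ∀ y : ZMod (p ^ r), c * (y - 1) = 0 → (p : ZMod (p ^ r)) * (y - 1) ^ 2 = 0 := by
    intro y hy
    obtain ⟨z, hz⟩ := pow_sub_dvd_of_pow_mul_eq_zero hp (by omega) hy
    have h : (p : ZMod (p ^ r)) ^ (1 + (r - m) * 2) = 0 := natCast_pow_eq_zero (by omega)
    rw [hz, mul_pow, ← mul_assoc, ← pow_mul, ← pow_succ', add_comm, h, zero_mul]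
  rw [S_eq_sum_unitSum]
  refine sum_eq_zero_of_sum_sq_eq_zero ?_ ?_
  · intro u hu
    have hu' : unitSum u ≠ 0 := fun h => hu (by rw [h, zero_pow (by omega)])
    rw [unitSum_eq_stationary hcc] at hu'
    obtain ⟨x, -, hx⟩ := exists_ne_zero_of_sum_ne_zero hu'
    have hx' : c * (u * x - (x⁻¹ : (ZMod (p ^ r))ˣ)) = 0 := by
      by_contra h
      exact hx (if_neg h)
    have hxx : (x : ZMod (p ^ r)) * (x⁻¹ : (ZMod (p ^ r))ˣ) = 1 := x.mul_inv
    have hdvd : (p : ZMod (p ^ r)) ∣ u * x ^ 2 - 1 := by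
      refine (dvd_pow_self _ (show r - m ≠ 0 by omega)).trans
        (pow_sub_dvd_of_pow_mul_eq_zero hp (by omega) ?_)
      linear_combination (x : ZMod (p ^ r)) * hx' + c * hxx
    obtain ⟨b, hb⟩ := exists_sq_eq_of_dvd_sub_one hp hpodd hdvd
    have hnil : IsNilpotent (u * x ^ 2 - 1) := by
      obtain ⟨z, hz⟩ := hdvd
      exact ⟨r, by rw [hz, mul_pow, natCast_pow_eq_zero le_rfl, zero_mul]⟩
    have hbu : IsUnit b := by
      have h := hnil.isUnit_one_add
      rw [add_sub_cancel, ← hb] at h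
      exact (isUnit_pow_iff two_ne_zero).1 h
    obtain ⟨b, rfl⟩ := hbu
    refine ⟨b * x⁻¹, ?_⟩
    rw [Units.val_mul, mul_pow, hb, mul_assoc, ← mul_pow, hxx, one_pow, mul_one]
  · simp only [unitSum_sq h₂ hcc hc₀, add_pow]
    rw [sum_comm]
    refine sum_eq_zero fun k hk => ?_
    have hkn : k ≤ n := by simpa [Nat.lt_succ_iff] using hk
    have hd : IsNilpotent (p : ZMod (p ^ r)) := ⟨r, natCast_pow_eq_zero le_rfl⟩
    refine sum_units_eq_zero_of_shift hd
      (f := fun w => localSum c w ^ k * localSum c (-w) ^ (n - k) * (n.choose k : ℂ))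
      (a := ZMod.stdAddChar ((2 * (2 * k - n) * p : ℤ) : ZMod (p ^ r))) ?_ ?_
    · rw [← AddChar.map_zero_eq_one (ZMod.stdAddChar (N := p ^ r)),
        ZMod.injective_stdAddChar.ne_iff, Ne, ZMod.intCast_zmod_eq_zero_iff_dvd]
      intro h
      have hrp : ((p ^ r : ℕ) : ℤ) = ((p ^ (r - 1) : ℕ) : ℤ) * p := by
        rw [← Nat.cast_mul, ← pow_succ, Nat.sub_add_cancel (by omega)]
      rw [hrp] at h
      have h' := Int.dvd_of_mul_dvd_mul_right (by exact_mod_cast hp.ne_zero) h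
      have hcop : IsCoprime ((p ^ (r - 1) : ℕ) : ℤ) 2 := by
        have : Nat.Coprime (p ^ (r - 1)) 2 :=
          ((Nat.coprime_primes hp Nat.prime_two).2 hpodd).pow_left _
        exact_mod_cast Nat.isCoprime_iff_coprime.2 this
      have h'' := hcop.dvd_of_dvd_mul_left h'
      obtain ⟨j, hj⟩ := hodd
      have hle := Int.le_of_dvd (abs_pos.2 (by omega)) ((dvd_abs _ _).2 h'')
      have habs : |2 * (k : ℤ) - n| ≤ n := abs_le.2 ⟨by omega, by omega⟩
      omega
    · intro w
      have hneg : localSum c (-(w + p)) =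
          ZMod.stdAddChar (-(2 * p : ZMod (p ^ r))) * localSum c (-w) := by
        rw [neg_add, localSum_add (d := -(p : ZMod (p ^ r)))
          (fun y hy => by rw [neg_mul, hcd y hy, neg_zero]), mul_neg]
      have hchar : ZMod.stdAddChar ((2 * (2 * k - n) * p : ℤ) : ZMod (p ^ r)) =
          ZMod.stdAddChar (2 * p : ZMod (p ^ r)) ^ k *
            ZMod.stdAddChar (-(2 * p : ZMod (p ^ r))) ^ (n - k) := by
        rw [← AddChar.map_nsmul_eq_pow, ← AddChar.map_nsmul_eq_pow, ← AddChar.map_add_eq_mul]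
        congr 1
        push_cast [nsmul_eq_mul, Nat.cast_sub hkn]
        ring
      rw [hneg, localSum_add hcd, hchar]
      ring
end

section
/- Let n ≥ 1 be an odd integer. Then S_n(2^r) = 0 for every integer r > 1. -/
open Finset

/-- Translating the first argument of a Kloosterman sum of even modulus `2 * m` by `m`
changes its sign. -/
theorem Kl_two_mul_add_half {m : ℕ} (hm : m ≠ 0) (u v : ℤ) :
    Kl (2 * m) (u + m) v = -Kl (2 * m) u v := by
  unfold Kl
  rw [← Finset.sum_neg_distrib]
  refine Finset.sum_congr rfl fun x _ => ?_
  split_ifs with hx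
  · obtain ⟨k, rfl⟩ : Odd x := Nat.coprime_two_right.mp hx.coprime_mul_right_right
    have hm' : (m : ℂ) ≠ 0 := Nat.cast_ne_zero.mpr hm
    conv_rhs => rw [← Complex.exp_add_pi_mul_I, ← Complex.exp_periodic.nat_mul k]
    congr 1
    push_cast
    field_simp
    ring
  · simp

/-- Odd power moments of Kloosterman sums vanish for every positive even modulus. -/
theorem S_two_mul_eq_zero {n m : ℕ} (hodd : Odd n) (hm : m ≠ 0) : S n (2 * m) = 0 := by
  have h (i : ℕ) : Kl (2 * m) (((m + i : ℕ) : ℤ) + 1) 1 ^ n =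
      -Kl (2 * m) ((i : ℤ) + 1) 1 ^ n := by
    rw [← hodd.neg_pow, ← Kl_two_mul_add_half hm]
    congr 2
    push_cast
    ring
  unfold S
  nth_rewrite 1 [two_mul]
  rw [Finset.sum_range_add]
  simp only [h, Finset.sum_neg_distrib, add_neg_cancel]

/-- Let `n ≥ 1` be odd. Then `S_n(2^r) = 0` for every integer `r > 1`. -/
theorem odd_power_moment_vanishes_two (n r : ℕ) (hn : 1 ≤ n) (hodd : Odd n)
    (hr : 1 < r) :
    S n (2 ^ r) = 0 := by
  obtain ⟨k, rfl⟩ := Nat.exists_eq_add_of_lt hr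
  rw [pow_succ']
  exact S_two_mul_eq_zero hodd (pow_ne_zero _ two_ne_zero)
end

section
/- Let n ≥ 2 be an even integer and let p be an odd prime. If r is an integer with r > log_p(n/2) + 1 (equivalently 2·p^{r-1} > n), then S_n(p^r) = C(n−1, n/2 − 1) · ((p−1)/p) · p^{(n/2 + 1)r}, where C(a,b) denotes the binomial coefficient. -/
open Finset

open IsLocalRing

section FiniteLocalRing

variable {R : Type*} [CommRing R] [IsLocalRing R]

theorem isUnit_add_of_mem_maximalIdeal {a i : R} (ha : IsUnit a) (hi : i ∈ maximalIdeal R) :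
    IsUnit (a + i) := by
  by_contra h
  have h' : a + i ∈ maximalIdeal R := (mem_maximalIdeal _).2 h
  exact (mem_maximalIdeal _).1 ((Ideal.add_mem_iff_left _ hi).1 h') ha

variable (R) in
/-- The group of principal units `1 + 𝔪` of a local ring. -/
noncomputable def principalUnits : Subgroup Rˣ := (Units.map (residue R).toMonoidHom).ker

theorem mem_principalUnits {x : Rˣ} : x ∈ principalUnits R ↔ (x : R) - 1 ∈ maximalIdeal R := by
  rw [principalUnits, MonoidHom.mem_ker, Units.ext_iff, ← residue_eq_zero_iff]
  simp [sub_eq_zero]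

variable (R) in
/-- The bijection `x ↦ x - 1` from the principal units to the maximal ideal. -/
noncomputable def principalUnitsEquiv : principalUnits R ≃ maximalIdeal R where
  toFun x := ⟨(x : Rˣ) - 1, mem_principalUnits.1 x.2⟩
  invFun i := ⟨(isUnit_add_of_mem_maximalIdeal isUnit_one i.2).unit,
    mem_principalUnits.2 (by simp)⟩
  left_inv x := by ext; simp
  right_inv i := by ext; simp

theorem bijective_of_injective_principalUnits [Finite R] {f : principalUnits R → maximalIdeal R}
    (hf : Function.Injective f) : Function.Bijective f :=
  hf.bijective_of_nat_card_le (Nat.card_congr (principalUnitsEquiv R)).ge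

theorem isUnit_of_sub_mem_maximalIdeal {a b : R} (ha : IsUnit a) (h : b - a ∈ maximalIdeal R) :
    IsUnit b := by
  simpa using isUnit_add_of_mem_maximalIdeal ha h

theorem sq_bijective_principalUnits [Finite R] (h2 : IsUnit (2 : R)) :
    Function.Bijective (fun x : principalUnits R => x ^ 2) := by
  refine Finite.injective_iff_bijective.1 fun x y hxy => ?_
  have hx := mem_principalUnits.1 x.2
  have hy := mem_principalUnits.1 y.2
  have hu : IsUnit (((x : Rˣ) : R) + (y : Rˣ)) :=
    isUnit_of_sub_mem_maximalIdeal h2 (by convert add_mem hx hy using 1; ring)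
  have h : (((x : Rˣ) : R)) ^ 2 = ((y : Rˣ) : R) ^ 2 := by
    simpa [Units.ext_iff, Subtype.ext_iff] using hxy
  ext
  exact sub_eq_zero.1 (hu.mul_left_eq_zero.1 (by linear_combination h))

theorem exists_sq_eq_of_sub_one_mem [Finite R] (h2 : IsUnit (2 : R)) {a : R}
    (ha : a - 1 ∈ maximalIdeal R) : ∃ w : Rˣ, (w : R) ^ 2 = a := by
  obtain ⟨w, hw⟩ := (sq_bijective_principalUnits h2).2
    ((principalUnitsEquiv R).symm ⟨a - 1, ha⟩)
  refine ⟨w, ?_⟩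
  have := congrArg (fun x : principalUnits R => ((x : Rˣ) : R)) hw
  simpa [principalUnitsEquiv] using this

theorem sub_inv_bijective [Finite R] (h2 : IsUnit (2 : R)) :
    ∃ f : principalUnits R → maximalIdeal R, Function.Bijective f ∧
      ∀ x, (f x : R) = ((x : Rˣ) : R) - ((x⁻¹ : principalUnits R) : Rˣ) := by
  refine ⟨fun x => ⟨((x : Rˣ) : R) - ((x⁻¹ : principalUnits R) : Rˣ), ?_⟩,
    bijective_of_injective_principalUnits fun x y hxy => ?_, fun x => rfl⟩
  · convert sub_mem (mem_principalUnits.1 x.2) (mem_principalUnits.1 (x⁻¹).2) using 1; ring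
  · have hz := mem_principalUnits.1 (x * y).2
    have hu : IsUnit ((((x * y : principalUnits R) : Rˣ) : R) + 1) :=
      isUnit_of_sub_mem_maximalIdeal h2 (by convert hz using 1; ring)
    have h := congrArg Subtype.val hxy
    have hx : (((x : Rˣ) : R)) * (((x : Rˣ)⁻¹ : Rˣ) : R) = 1 := Units.mul_inv _
    have hy : (((y : Rˣ) : R)) * (((y : Rˣ)⁻¹ : Rˣ) : R) = 1 := Units.mul_inv _
    simp only [Subgroup.coe_inv, Subgroup.coe_mul, Units.val_mul] at h hu
    ext
    refine sub_eq_zero.1 (hu.mul_left_eq_zero.1 ?_)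
    linear_combination ((x : Rˣ) : R) * ((y : Rˣ) : R) * h + ((y : Rˣ) : R) * hx
      - ((x : Rˣ) : R) * hy

open scoped Classical in
theorem sum_addChar_mul_eq_ite [Fintype (maximalIdeal R)] {e : AddChar R ℂ} (he : e.IsPrimitive)
    (b : R) :
    ∑ i : maximalIdeal R, e (b * i) =
      if ∀ i ∈ maximalIdeal R, b * i = 0 then (Fintype.card (maximalIdeal R) : ℂ) else 0 := by
  split_ifs with h
  · simp [h]
  · push Not at h
    obtain ⟨i, hi, hbi⟩ := h
    obtain ⟨x, hx⟩ := AddChar.ne_one_iff.1 (he hbi)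
    refine AddChar.sum_eq_zero_of_ne_one (ψ := (e.mulShift b).compAddMonoidHom
      (maximalIdeal R).subtype.toAddMonoidHom) ?_
    refine AddChar.ne_one_iff.2 ⟨⟨i * x, Ideal.mul_mem_right _ _ hi⟩, ?_⟩
    simpa [AddChar.mulShift_apply, mul_assoc] using hx

theorem mem_maximalIdeal_of_annihilates (hR : ¬ IsField R) {b : R}
    (hb : ∀ i ∈ maximalIdeal R, b * i = 0) : b ∈ maximalIdeal R := by
  rw [mem_maximalIdeal, mem_nonunits_iff]
  intro hu
  refine hR (isField_iff_maximalIdeal_eq.2 ((Submodule.eq_bot_iff _).2 fun i hi => ?_))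
  exact hu.mul_right_eq_zero.1 (hb i hi)

open scoped Classical in
theorem card_maximalIdeal_mul_card_annihilator [Fintype R] [Fintype (maximalIdeal R)]
    {e : AddChar R ℂ} (he : e.IsPrimitive) (hR : ¬ IsField R) :
    (Fintype.card (maximalIdeal R) : ℂ) *
      #{d : maximalIdeal R | ∀ i ∈ maximalIdeal R, (d : R) * i = 0} = Fintype.card R := by
  have h1 : ∑ b : R, ∑ i : maximalIdeal R, e (b * i) = Fintype.card R := by
    rw [sum_comm, Fintype.sum_eq_single 0]
    · simp
    · intro i hi
      refine Eq.trans (sum_congr rfl fun b _ => by rw [mul_comm]) ?_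
      exact AddChar.sum_eq_zero_of_ne_one (he (a := (i : R)) (by simpa using hi))
  rw [← h1]
  have h2 : ∑ b : R, ∑ i : maximalIdeal R, e (b * i) =
      ∑ b ∈ {b : R | ∀ i ∈ maximalIdeal R, b * i = 0},
        (Fintype.card (maximalIdeal R) : ℂ) := by
    rw [sum_filter]
    refine sum_congr rfl fun b _ => ?_
    convert sum_addChar_mul_eq_ite he b
  rw [h2, sum_const, nsmul_eq_mul, mul_comm]
  congr 2
  refine card_bij (fun d _ => (d : R)) (fun d hd => by simpa using hd)
    (fun _ _ _ _ h => Subtype.ext h) fun b hb => ?_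
  simp only [mem_filter, mem_univ, true_and] at hb
  exact ⟨⟨b, mem_maximalIdeal_of_annihilates hR hb⟩, by simpa using hb, rfl⟩

/-- The quadratic Gauss sum over the maximal ideal. -/
noncomputable def idealGaussSum [Fintype (maximalIdeal R)] (e : AddChar R ℂ) (a : R) : ℂ :=
  ∑ i : maximalIdeal R, e (a * (i : R) ^ 2)

theorem idealGaussSum_mul_neg [Fintype R] [Fintype (maximalIdeal R)] {e : AddChar R ℂ}
    (he : e.IsPrimitive) (hR : ¬ IsField R) (h2 : IsUnit (2 : R)) {a : R} (ha : IsUnit a) :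
    idealGaussSum e a * idealGaussSum e (-a) = Fintype.card R := by
  classical
  have key : ∀ d j : maximalIdeal R, e (a * ((d + j : maximalIdeal R) : R) ^ 2) *
      e (-a * (j : R) ^ 2) = e (a * (d : R) ^ 2) * e (2 * a * d * j) := by
    intro d j
    rw [← AddChar.map_add_eq_mul, ← AddChar.map_add_eq_mul]
    congr 1
    push_cast
    ring
  have hann : ∀ d : maximalIdeal R, (∀ i ∈ maximalIdeal R, 2 * a * (d : R) * i = 0) ↔
      ∀ i ∈ maximalIdeal R, (d : R) * i = 0 := fun d => by
    refine forall₂_congr fun i _ => ?_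
    rw [mul_assoc, (h2.mul ha).mul_right_eq_zero]
  calc idealGaussSum e a * idealGaussSum e (-a)
      = ∑ j : maximalIdeal R, ∑ d : maximalIdeal R,
          e (a * ((d + j : maximalIdeal R) : R) ^ 2) * e (-a * (j : R) ^ 2) := by
        rw [idealGaussSum, idealGaussSum, sum_mul_sum, sum_comm]
        refine sum_congr rfl fun j _ => ?_
        exact (Equiv.sum_comp (Equiv.addRight j) fun i : maximalIdeal R =>
          e (a * (i : R) ^ 2) * e (-a * (j : R) ^ 2)).symm
    _ = ∑ d : maximalIdeal R, if ∀ i ∈ maximalIdeal R, (d : R) * i = 0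
          then (Fintype.card (maximalIdeal R) : ℂ) else 0 := by
        simp only [key]
        rw [sum_comm]
        refine sum_congr rfl fun d _ => ?_
        rw [← mul_sum, sum_addChar_mul_eq_ite he]
        simp only [hann]
        split_ifs with h
        · simp [pow_two, h d d.2]
        · simp
    _ = Fintype.card R := by
        rw [← sum_filter, sum_const, nsmul_eq_mul, mul_comm,
          card_maximalIdeal_mul_card_annihilator he hR]

theorem idealGaussSum_mul_sq [Fintype (maximalIdeal R)] (e : AddChar R ℂ) (a : R) (w : Rˣ) :
    idealGaussSum e (a * (w : R) ^ 2) = idealGaussSum e a := by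
  have hinj : Function.Bijective (fun i : maximalIdeal R =>
      (⟨(w : R) * i, Ideal.mul_mem_left _ _ i.2⟩ : maximalIdeal R)) := by
    refine Finite.injective_iff_bijective.1 fun i j h => ?_
    exact Subtype.ext (w.isUnit.mul_left_cancel (congrArg Subtype.val h))
  rw [idealGaussSum, idealGaussSum]
  refine Eq.trans (sum_congr rfl fun i _ => ?_)
    (hinj.sum_comp fun i : maximalIdeal R => e (a * (i : R) ^ 2))
  dsimp only
  congr 1
  ring

theorem idealGaussSum_add [Finite R] [Fintype (maximalIdeal R)] (e : AddChar R ℂ)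
    (h2 : IsUnit (2 : R)) {a i : R} (ha : IsUnit a) (hi : i ∈ maximalIdeal R) :
    idealGaussSum e (a + i) = idealGaussSum e a := by
  obtain ⟨a, rfl⟩ := ha
  obtain ⟨w, hw⟩ := exists_sq_eq_of_sub_one_mem h2 (a := 1 + ((a⁻¹ : Rˣ) : R) * i)
    (by rw [add_sub_cancel_left]; exact Ideal.mul_mem_left _ _ hi)
  have : (a : R) + i = a * (w : R) ^ 2 := by
    rw [hw, mul_add, Units.mul_inv_cancel_left, mul_one]
  rw [this, idealGaussSum_mul_sq]

theorem sum_principalUnits [Finite R] [Fintype (principalUnits R)] [Fintype (maximalIdeal R)]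
    (e : AddChar R ℂ) (h2 : IsUnit (2 : R)) (a : R) :
    ∑ x : principalUnits R, e (a * ((x : Rˣ) : R) + a * (((x : Rˣ)⁻¹ : Rˣ) : R)) =
      e (2 * a) * idealGaussSum e a := by
  obtain ⟨f, hf, hfx⟩ := sub_inv_bijective h2
  rw [← (sq_bijective_principalUnits h2).sum_comp fun x : principalUnits R =>
    e (a * ((x : Rˣ) : R) + a * (((x : Rˣ)⁻¹ : Rˣ) : R)), idealGaussSum,
    ← hf.sum_comp fun i : maximalIdeal R => e (a * (i : R) ^ 2), mul_sum]
  refine sum_congr rfl fun x _ => ?_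
  rw [← AddChar.map_add_eq_mul, hfx]
  congr 1
  have hx : (((x : Rˣ) : R)) * (((x : Rˣ)⁻¹ : Rˣ) : R) = 1 := Units.mul_inv _
  simp only [Subgroup.coe_inv, Subgroup.coe_pow, ← inv_pow, Units.val_pow_eq_pow_val]
  linear_combination (2 * a) * hx

/-- The Kloosterman sum over a finite ring attached to an additive character. -/
noncomputable def ringKloosterman [Fintype Rˣ] (e : AddChar R ℂ) (u v : R) : ℂ :=
  ∑ x : Rˣ, e (u * x + v * ((x⁻¹ : Rˣ) : R))

theorem sum_translate_principalUnits [Finite R] [Fintype (principalUnits R)] {e : AddChar R ℂ}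
    (he : e.IsPrimitive) (hR : ¬ IsField R) {u v : R} {x : Rˣ}
    (hx : IsUnit (u * (x : R) ^ 2 - v)) :
    ∑ h : principalUnits R,
      e (u * ((x * h : Rˣ) : R) + v * (((x * h)⁻¹ : Rˣ) : R)) = 0 := by
  have := Fintype.ofFinite (maximalIdeal R)
  have hxx : (x : R) * ((x⁻¹ : Rˣ) : R) = 1 := Units.mul_inv _
  have hinv : ∀ h : principalUnits R, ((h : Rˣ) : R) * (((h : Rˣ)⁻¹ : Rˣ) : R) = 1 :=
    fun h => Units.mul_inv _
  let f : principalUnits R → maximalIdeal R := fun h =>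
    ⟨(((h : Rˣ) : R) - 1) * (u * x - v * ((x⁻¹ : Rˣ) : R) * (((h : Rˣ)⁻¹ : Rˣ) : R)),
      Ideal.mul_mem_right _ _ (mem_principalUnits.1 h.2)⟩
  have hf : Function.Injective f := by
    intro h k hhk
    have hhk' := congrArg Subtype.val hhk
    have hu : IsUnit (u * (x : R) ^ 2 * ((h * k : principalUnits R) : Rˣ) - v) := by
      refine isUnit_of_sub_mem_maximalIdeal hx ?_
      convert Ideal.mul_mem_left _ (u * (x : R) ^ 2) (mem_principalUnits.1 (h * k).2) using 1
      ring
    simp only [f, Subgroup.coe_mul, Units.val_mul] at hhk' hu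
    ext
    refine sub_eq_zero.1 (hu.mul_left_eq_zero.1 ?_)
    have e1 := hinv h
    have e2 := hinv k
    generalize ((h : Rˣ) : R) = H at *
    generalize ((k : Rˣ) : R) = K at *
    generalize (((h : Rˣ)⁻¹ : Rˣ) : R) = H' at *
    generalize (((k : Rˣ)⁻¹ : Rˣ) : R) = K' at *
    generalize ((x⁻¹ : Rˣ) : R) = X' at *
    linear_combination (x : R) * H * K * hhk' + v * (H - K) * hxx + (v * x * X' * K * (H - 1)) * e1
      - (v * x * X' * H * (K - 1)) * e2
  have hbij := bijective_of_injective_principalUnits hf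
  have hterm : ∀ h : principalUnits R,
      e (u * ((x * h : Rˣ) : R) + v * (((x * h)⁻¹ : Rˣ) : R)) =
        e (u * x + v * ((x⁻¹ : Rˣ) : R)) * e (1 * (f h : R)) := by
    intro h
    rw [← AddChar.map_add_eq_mul]
    congr 1
    simp only [f, mul_inv, Units.val_mul]
    linear_combination (v * ((x⁻¹ : Rˣ) : R)) * hinv h
  simp only [hterm]
  rw [← mul_sum, hbij.sum_comp fun i : maximalIdeal R => e (1 * (i : R)),
    sum_addChar_mul_eq_ite he, if_neg, mul_zero]
  intro h
  exact (mem_maximalIdeal _).1 (mem_maximalIdeal_of_annihilates hR h) isUnit_one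

open scoped Classical in
theorem ringKloosterman_eq_sum_filter [Finite R] [Fintype Rˣ] {e : AddChar R ℂ}
    (he : e.IsPrimitive) (hR : ¬ IsField R) (u v : R) :
    ringKloosterman e u v =
      ∑ x ∈ {x : Rˣ | u * (x : R) ^ 2 - v ∈ maximalIdeal R}, e (u * x + v * ((x⁻¹ : Rˣ) : R)) := by
  rw [ringKloosterman, ← sum_filter_add_sum_filter_not univ
    (fun x : Rˣ => u * (x : R) ^ 2 - v ∈ maximalIdeal R), add_eq_left]
  have hcard : (Fintype.card (principalUnits R) : ℂ) ≠ 0 :=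
    Nat.cast_ne_zero.2 Fintype.card_ne_zero
  refine (mul_eq_zero.1 ?_).resolve_left hcard
  set F : Rˣ → ℂ := fun x => e (u * x + v * ((x⁻¹ : Rˣ) : R))
  set A : Finset Rˣ := {x : Rˣ | ¬ u * (x : R) ^ 2 - v ∈ maximalIdeal R} with hA
  have hstable : ∀ (h : principalUnits R) (x : Rˣ), x * (h : Rˣ) ∈ A ↔ x ∈ A := by
    intro h x
    simp only [hA, mem_filter, mem_univ, true_and]
    have hd := Ideal.mul_mem_left _ (u * (x : R) ^ 2) (mem_principalUnits.1 (h ^ 2).2)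
    rw [show u * ((x * (h : Rˣ) : Rˣ) : R) ^ 2 - v = u * (x : R) ^ 2 *
      ((((h ^ 2 : principalUnits R) : Rˣ) : R) - 1) + (u * (x : R) ^ 2 - v) by
        push_cast; ring, Ideal.add_mem_iff_right _ hd]
  have hshift : ∀ h : principalUnits R, ∑ x ∈ A, F (x * h) = ∑ x ∈ A, F x := fun h =>
    sum_equiv (Equiv.mulRight (h : Rˣ)) (fun x => (hstable h x).symm) fun _ _ => rfl
  calc (Fintype.card (principalUnits R) : ℂ) * ∑ x ∈ A, F x
      = ∑ h : principalUnits R, ∑ x ∈ A, F (x * h) := by simp [hshift]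
    _ = ∑ x ∈ A, ∑ h : principalUnits R, F (x * h) := sum_comm
    _ = 0 := sum_eq_zero fun x hx => sum_translate_principalUnits he hR (by
        simpa [hA, mem_maximalIdeal, mem_nonunits_iff] using hx)

theorem ringKloosterman_eq_zero [Finite R] [Fintype Rˣ] {e : AddChar R ℂ}
    (he : e.IsPrimitive) (hR : ¬ IsField R) (h2 : IsUnit (2 : R)) {u : R}
    (hu : ¬ ∃ a : Rˣ, (a : R) ^ 2 = u) : ringKloosterman e u 1 = 0 := by
  classical
  rw [ringKloosterman_eq_sum_filter he hR, filter_false_of_mem, sum_empty]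
  intro x _ hx
  obtain ⟨w, hw⟩ := exists_sq_eq_of_sub_one_mem h2 hx
  refine hu ⟨w * x⁻¹, ?_⟩
  have hxx : (x : R) * ((x⁻¹ : Rˣ) : R) = 1 := Units.mul_inv _
  rw [Units.val_mul, mul_pow, hw]
  linear_combination u * (x * ((x⁻¹ : Rˣ) : R) + 1) * hxx

theorem ringKloosterman_sq [Finite R] [Fintype Rˣ] [Fintype (maximalIdeal R)] {e : AddChar R ℂ}
    (he : e.IsPrimitive) (hR : ¬ IsField R) (h2 : IsUnit (2 : R)) (a : Rˣ) :
    ringKloosterman e ((a : R) ^ 2) 1 =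
      e (2 * a) * idealGaussSum e a + e (2 * -a) * idealGaussSum e (-a) := by
  classical
  have hsubst : ringKloosterman e ((a : R) ^ 2) 1 = ringKloosterman e a a := by
    rw [ringKloosterman, ringKloosterman]
    refine Fintype.sum_equiv (Equiv.mulLeft a) _ _ fun x => ?_
    congr 1
    simp only [Equiv.coe_mulLeft, mul_inv, Units.val_mul, Units.mul_inv_cancel_left]
    ring
  have hmem : ∀ x : Rˣ, (a : R) * (x : R) ^ 2 - a ∈ maximalIdeal R ↔
      x ∈ principalUnits R ∨ -x ∈ principalUnits R := by
    intro x
    rw [mem_principalUnits, mem_principalUnits, Units.val_neg]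
    simp only [mem_maximalIdeal, mem_nonunits_iff]
    rw [show (a : R) * (x : R) ^ 2 - a = a * ((x - 1) * -(-x - 1)) by ring, IsUnit.mul_iff,
      IsUnit.mul_iff, IsUnit.neg_iff]
    simp only [Units.isUnit, true_and]
    tauto
  rw [hsubst, ringKloosterman_eq_sum_filter he hR, ← sum_principalUnits e h2,
    ← sum_principalUnits e h2]
  simp only [hmem]
  rw [filter_or, sum_union]
  · congr 1
    · exact sum_subtype _ (by simp) _
    · rw [← sum_subtype (univ.filter (· ∈ principalUnits R)) (by simp)
        fun x : Rˣ => e (-(a : R) * (x : R) + -(a : R) * ((x⁻¹ : Rˣ) : R))]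
      exact sum_equiv (Equiv.neg Rˣ) (by simp) (by simp)
  · rw [disjoint_filter]
    intro x _ hx hx'
    rw [mem_principalUnits] at hx hx'
    refine (mem_maximalIdeal _).1 ?_ h2
    convert neg_mem (add_mem hx hx') using 1
    rw [Units.val_neg]
    ring

theorem two_mul_sum_eq_sum_sq [Fintype R] [Fintype Rˣ] (h2 : IsUnit (2 : R)) (F : R → ℂ)
    (hF : ∀ u, (¬ ∃ a : Rˣ, (a : R) ^ 2 = u) → F u = 0) :
    2 * ∑ u, F u = ∑ a : Rˣ, F ((a : R) ^ 2) := by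
  classical
  rw [← sum_fiberwise univ (fun a : Rˣ => (a : R) ^ 2), mul_sum]
  refine sum_congr rfl fun u _ => ?_
  rw [sum_congr rfl fun a ha => by rw [(mem_filter.1 ha).2], sum_const, nsmul_eq_mul]
  by_cases hu : ∃ a : Rˣ, (a : R) ^ 2 = u
  · obtain ⟨a, rfl⟩ := hu
    have hne : a ≠ -a := fun h => by
      have h' : (2 : R) * a = 0 := by
        have := congrArg Units.val h
        rw [Units.val_neg] at this
        linear_combination this
      exact not_isUnit_zero (h' ▸ h2.mul a.isUnit)
    have : ({b : Rˣ | (b : R) ^ 2 = (a : R) ^ 2} : Finset Rˣ) = {a, -a} := by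
      ext b
      simp only [mem_filter, mem_univ, true_and, mem_insert, mem_singleton]
      constructor
      · intro h
        have h0 : ((b : R) - a) * (b + a) = 0 := by linear_combination h
        rcases isUnit_or_isUnit_of_isUnit_add
          (show IsUnit (((b : R) + a) + -(b - a)) by
            convert h2.mul a.isUnit using 1; ring) with hu | hu
        · exact Or.inl (Units.ext (sub_eq_zero.1 (hu.mul_left_eq_zero.1 h0)))
        · refine Or.inr (Units.ext ?_)
          rw [Units.val_neg]
          exact eq_neg_of_add_eq_zero_left ((IsUnit.neg_iff _).1 hu |>.mul_right_eq_zero.1 h0)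
      · rintro (rfl | rfl) <;> simp
    rw [this, card_pair hne]
    norm_num
  · simp [hF u hu]

theorem sum_units_mul_idealGaussSum_eq_zero [Finite R] [Fintype Rˣ] [Fintype (maximalIdeal R)]
    {e : AddChar R ℂ} (he : e.IsPrimitive) (h2 : IsUnit (2 : R)) (k l : ℕ) {i : R}
    (hi : i ∈ maximalIdeal R) (hkl : ((k : R) - l) * i ≠ 0) :
    ∑ a : Rˣ, (e (2 * a) * idealGaussSum e a) ^ k * (e (2 * -a) * idealGaussSum e (-a)) ^ l = 0 := by
  obtain ⟨x, hx⟩ := AddChar.ne_one_iff.1 (he (a := 2 * (((k : R) - l) * i))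
    fun h => hkl (h2.mul_right_eq_zero.1 h))
  rw [AddChar.mulShift_apply] at hx
  have hix : i * x ∈ maximalIdeal R := Ideal.mul_mem_right _ _ hi
  let t : Rˣ → Rˣ := fun a => (isUnit_add_of_mem_maximalIdeal a.isUnit hix).unit
  have ht : ∀ a, (t a : R) = a + i * x := fun a => rfl
  have hbij : Function.Bijective t := Finite.injective_iff_bijective.1 fun a b hab => by
    have := congrArg Units.val hab
    rw [ht, ht] at this
    exact Units.ext (add_right_cancel this)
  set G : Rˣ → ℂ := fun a =>
    (e (2 * a) * idealGaussSum e a) ^ k * (e (2 * -a) * idealGaussSum e (-a)) ^ l with hG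
  have hGt : ∀ a, G (t a) = e (2 * (((k : R) - l) * i) * x) * G a := by
    intro a
    have e1 : e (2 * (((k : R) - l) * i) * x) = e (2 * (i * x)) ^ k * e (2 * -(i * x)) ^ l := by
      rw [← AddChar.map_nsmul_eq_pow, ← AddChar.map_nsmul_eq_pow, ← AddChar.map_add_eq_mul]
      congr 1
      simp only [nsmul_eq_mul]
      ring
    simp only [hG, ht]
    rw [idealGaussSum_add e h2 a.isUnit hix, neg_add,
      idealGaussSum_add e h2 a.isUnit.neg (neg_mem hix), mul_add, mul_add,
      AddChar.map_add_eq_mul, AddChar.map_add_eq_mul, e1]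
    ring
  have hsum : ∑ a, G a = e (2 * (((k : R) - l) * i) * x) * ∑ a, G a := by
    rw [mul_sum, ← hbij.sum_comp]
    exact sum_congr rfl fun a _ => hGt a
  have h0 : (e (2 * (((k : R) - l) * i) * x) - 1) * ∑ a, G a = 0 := by
    linear_combination -hsum
  exact (mul_eq_zero.1 h0).resolve_left (sub_ne_zero.2 hx)

theorem two_mul_sum_ringKloosterman_pow [Fintype R] [Fintype Rˣ] {e : AddChar R ℂ}
    (he : e.IsPrimitive) (hR : ¬ IsField R) (h2 : IsUnit (2 : R)) {h : ℕ} (hpos : h ≠ 0)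
    (hh : ∀ j : ℤ, j ≠ 0 → |j| ≤ h → ∃ i ∈ maximalIdeal R, (j : R) * i ≠ 0) :
    2 * ∑ u, ringKloosterman e u 1 ^ (2 * h) =
      (2 * h).choose h * Fintype.card Rˣ * (Fintype.card R : ℂ) ^ h := by
  have := Fintype.ofFinite (maximalIdeal R)
  rw [two_mul_sum_eq_sum_sq h2 _ fun u hu => by
    rw [ringKloosterman_eq_zero he hR h2 hu, zero_pow (by omega)]]
  simp only [ringKloosterman_sq he hR h2, add_pow]
  rw [sum_comm, sum_eq_single_of_mem h (mem_range.2 (by omega))]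
  · have hmid : ∀ a : Rˣ, (e (2 * a) * idealGaussSum e a) ^ h *
        (e (2 * -a) * idealGaussSum e (-a)) ^ (2 * h - h) = (Fintype.card R : ℂ) ^ h := by
      intro a
      rw [show 2 * h - h = h by omega, ← mul_pow, mul_mul_mul_comm,
        idealGaussSum_mul_neg he hR h2 a.isUnit, ← AddChar.map_add_eq_mul]
      simp
    simp only [hmid, sum_const, card_univ, nsmul_eq_mul]
    ring
  · intro k hk hkh
    rw [mem_range] at hk
    rw [← sum_mul]
    obtain ⟨i, hi, hji⟩ := hh (k - h) (by omega) (by rw [abs_le]; omega)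
    rw [sum_units_mul_idealGaussSum_eq_zero he h2 k (2 * h - k) hi, zero_mul]
    intro h0
    refine hji (h2.mul_right_eq_zero.1 (Eq.trans ?_ h0))
    rw [Nat.cast_sub (by omega)]
    push_cast
    ring

end FiniteLocalRing

section ZMod

theorem isLocalRing_zmod_prime_pow {p r : ℕ} (hp : p.Prime) (hr : r ≠ 0) :
    IsLocalRing (ZMod (p ^ r)) := by
  have : NeZero (p ^ r) := ⟨pow_ne_zero _ hp.ne_zero⟩
  have : Nontrivial (ZMod (p ^ r)) :=
    ZMod.nontrivial_iff.2 (Nat.one_lt_pow hr hp.one_lt).ne'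
  refine IsLocalRing.of_nonunits_add fun a b ha hb => ?_
  obtain ⟨a, rfl⟩ := ZMod.natCast_zmod_surjective a
  obtain ⟨b, rfl⟩ := ZMod.natCast_zmod_surjective b
  rw [← Nat.cast_add]
  simp only [mem_nonunits_iff, ZMod.isUnit_natCast_iff_not_dvd_pow hp (Nat.pos_of_ne_zero hr),
    not_not] at *
  exact dvd_add ha hb

theorem sum_range_natCast_zmod {M : Type*} [AddCommMonoid M] (q : ℕ) [NeZero q]
    (f : ZMod q → M) : ∑ x ∈ range q, f x = ∑ x, f x := by
  refine sum_bij (fun x _ => (x : ZMod q)) (fun _ _ => mem_univ _) (fun a ha b hb h => ?_)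
    (fun b _ => ⟨b.val, mem_range.2 b.val_lt, ZMod.natCast_zmod_val b⟩) fun _ _ => rfl
  rw [ZMod.natCast_eq_natCast_iff'] at h
  rwa [Nat.mod_eq_of_lt (mem_range.1 ha), Nat.mod_eq_of_lt (mem_range.1 hb)] at h

theorem Kl_eq_ringKloosterman (q : ℕ) [NeZero q] (u v : ℤ) :
    Kl q u v = ringKloosterman (ZMod.stdAddChar (N := q)) u v := by
  classical
  have h1 : Kl q u v = ∑ x ∈ range q, if IsUnit (x : ZMod q) then
      ZMod.stdAddChar ((u : ZMod q) * (x : ZMod q) + (v : ZMod q) * (x : ZMod q)⁻¹) else 0 := by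
    refine sum_congr rfl fun x _ => ?_
    simp only [ZMod.isUnit_iff_coprime]
    split_ifs
    · have := ZMod.stdAddChar_coe (N := q) (u * x + v * ((x : ZMod q)⁻¹.val : ℕ))
      push_cast [ZMod.natCast_zmod_val] at this
      rw [this]
    · rfl
  rw [h1, sum_range_natCast_zmod q fun x : ZMod q => if IsUnit x then
    ZMod.stdAddChar ((u : ZMod q) * x + (v : ZMod q) * x⁻¹) else 0, ← sum_filter, ringKloosterman]
  symm
  refine sum_bij (fun x _ => (x : ZMod q)) (by simp) (fun _ _ _ _ h => Units.ext h)
    (fun b hb => ?_) (by simp)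
  obtain ⟨x, rfl⟩ := (mem_filter.1 hb).2
  exact ⟨x, mem_univ _, rfl⟩

theorem S_eq_sum_ringKloosterman (n q : ℕ) [NeZero q] :
    S n q = ∑ u, ringKloosterman (ZMod.stdAddChar (N := q)) u 1 ^ n := by
  rw [S, ← Equiv.sum_comp (Equiv.addRight (1 : ZMod q)), ← sum_range_natCast_zmod]
  refine sum_congr rfl fun u _ => ?_
  rw [Kl_eq_ringKloosterman]
  simp

end ZMod

/-- Let `n ≥ 2` be even and `p` an odd prime. If `r > log_p (n/2) + 1`
(equivalently `2·p^(r-1) > n`), then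
`S_n(p^r) = C(n-1, n/2-1) · ((p-1)/p) · p^((n/2+1)r)`. -/
theorem even_power_moment_formula (n p r : ℕ) (hn : 2 ≤ n) (heven : Even n)
    (hp : p.Prime) (hpodd : p ≠ 2) (hr : n < 2 * p ^ (r - 1)) :
    S n (p ^ r) =
      (Nat.choose (n - 1) (n / 2 - 1) : ℂ) * (((p : ℂ) - 1) / (p : ℂ)) *
        (p : ℂ) ^ ((n / 2 + 1) * r) := by
  obtain ⟨h, rfl⟩ := even_iff_exists_two_mul.1 heven
  obtain ⟨s, rfl⟩ : ∃ s, r = s + 2 := by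
    refine ⟨r - 2, ?_⟩
    by_contra hlt
    have : r - 1 = 0 := by omega
    rw [this, pow_zero] at hr
    omega
  rw [show s + 2 - 1 = s + 1 by omega] at hr
  have hlt : h < p ^ (s + 1) := by omega
  have : NeZero (p ^ (s + 2)) := ⟨pow_ne_zero _ hp.ne_zero⟩
  have := isLocalRing_zmod_prime_pow hp (Nat.succ_ne_zero (s + 1))
  have hpm : (p : ZMod (p ^ (s + 2))) ∈ maximalIdeal (ZMod (p ^ (s + 2))) :=
    ZMod.prime_natCast_not_isUnit_pow hp (by omega)
  have hann : ∀ j : ℤ, j ≠ 0 → |j| ≤ h → (j : ZMod (p ^ (s + 2))) * p ≠ 0 := by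
    intro j hj hjh h0
    have h1 : ((j * p : ℤ) : ZMod (p ^ (s + 2))) = 0 := by push_cast; exact h0
    rw [ZMod.intCast_zmod_eq_zero_iff_dvd, pow_succ, Nat.cast_mul] at h1
    have h2 := Int.le_of_dvd (abs_pos.2 hj) ((dvd_abs _ _).2
      (Int.dvd_of_mul_dvd_mul_right (by exact_mod_cast hp.ne_zero) h1))
    have : ((p ^ (s + 1) : ℕ) : ℤ) ≤ h := h2.trans hjh
    omega
  have h2 : IsUnit (2 : ZMod (p ^ (s + 2))) := by
    have := (ZMod.isUnit_natCast_iff_not_dvd_pow (a := 2) hp (Nat.succ_pos (s + 1))).2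
      fun hd => hpodd ((Nat.prime_dvd_prime_iff_eq hp Nat.prime_two).1 hd)
    exact_mod_cast this
  have hR : ¬ IsField (ZMod (p ^ (s + 2))) := fun hf => by
    rw [isField_iff_maximalIdeal_eq.1 hf, Ideal.mem_bot] at hpm
    exact hann 1 one_ne_zero (by simp; omega) (by rw [hpm, mul_zero])
  have key := two_mul_sum_ringKloosterman_pow (ZMod.isPrimitive_stdAddChar (p ^ (s + 2))) hR h2
    (h := h) (by omega) fun j hj hjh => ⟨p, hpm, hann j hj hjh⟩
  rw [← S_eq_sum_ringKloosterman, ZMod.card_units_eq_totient, ZMod.card,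
    Nat.totient_prime_pow_succ hp] at key
  have hchoose : (2 * h).choose h = 2 * (2 * h - 1).choose (h - 1) := by
    obtain ⟨k, rfl⟩ : ∃ k, h = k + 1 := ⟨h - 1, by omega⟩
    rw [← Nat.centralBinom_eq_two_mul_choose, Nat.centralBinom, mul_add, mul_one,
      Nat.choose_succ_succ]
    simp only [Nat.add_one_sub_one, two_mul (Nat.choose _ _)]
    congr 1
    exact Nat.choose_symm_half k
  have hp0 : (p : ℂ) ≠ 0 := by exact_mod_cast hp.ne_zero
  rw [hchoose, Nat.cast_mul, Nat.cast_mul, Nat.cast_pow, Nat.cast_pow,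
    Nat.cast_sub hp.one_le] at key
  rw [Nat.mul_div_cancel_left _ two_pos]
  have key2 : (2 : ℂ) * S (2 * h) (p ^ (s + 2)) = 2 * ((2 * h - 1).choose (h - 1) *
      (((p : ℂ) - 1) / p) * (p : ℂ) ^ ((h + 1) * (s + 2))) := by
    rw [key]
    field_simp
    push_cast
    ring
  exact mul_left_cancel₀ two_ne_zero key2
end

section
/- Let n ≥ 2 be an integer, p a prime, and r ≥ 2 an integer. Set q = p^r. Then S_n(q) = q²·W_n(q) − q²·p^{n−3}·W_n(q/p), i.e. S_n(p^r) = p^{2r}·(W_n(p^r) − p^{n−3}·W_n(p^{r−1})). -/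
open Finset

/-- `W_n(q)`: number of tuples `(x_1,…,x_{n-1})` of units mod `q` with
`x_1+⋯+x_{n-1}+1 ≡ 0` and `x_1⁻¹+⋯+x_{n-1}⁻¹+1 ≡ 0 (mod q)`. -/
noncomputable def W (n q : ℕ) : ℕ :=
  Nat.card {x : Fin (n - 1) → (ZMod q)ˣ //
    (∑ i, ((x i : ZMod q))) + 1 = 0 ∧
    (∑ i, (((x i)⁻¹ : (ZMod q)ˣ) : ZMod q)) + 1 = 0}

open ZMod in
/-- The Kloosterman sum as a sum over the unit group. -/
lemma Kl_eq_sum_units (q : ℕ) [NeZero q] (u v : ℤ) :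
    Kl q u v = ∑ x : (ZMod q)ˣ,
      stdAddChar ((u : ZMod q) * (x : ZMod q) + (v : ZMod q) * ((x⁻¹ : (ZMod q)ˣ) : ZMod q)) := by
  rw [Kl, ← Finset.sum_filter]
  symm
  refine Finset.sum_bij' (fun x _ ↦ (x : ZMod q).val)
    (fun x hx ↦ ZMod.unitOfCoprime x (Finset.mem_filter.1 hx).2) ?_ ?_ ?_ ?_ ?_
  · intro x _
    simpa [ZMod.val_lt] using ZMod.val_coe_unit_coprime x
  · simp
  · intro x _
    ext
    simp
  · intro x hx
    simpa using Nat.mod_eq_of_lt (Finset.mem_range.1 (Finset.mem_filter.1 hx).1)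
  · intro x _
    have h := stdAddChar_coe (N := q)
      (u * (x : ZMod q).val + v * (((x : ZMod q)⁻¹).val : ℕ))
    push_cast [ZMod.natCast_zmod_val] at h
    simpa [ZMod.inv_coe_unit] using h

open ZMod in
/-- Orthogonality of additive characters, summed over a complete residue system `1, …, q`. -/
lemma S_eq_sum_filter (n q : ℕ) [NeZero q] :
    S n q = q * ∑ f : Fin n → (ZMod q)ˣ, if ∑ i, (f i : ZMod q) = 0 then
      stdAddChar (∑ i, (((f i)⁻¹ : (ZMod q)ˣ) : ZMod q)) else 0 := by
  have h1 : S n q = ∑ u : ZMod q, (∑ x : (ZMod q)ˣ,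
      stdAddChar (u * (x : ZMod q) + ((x⁻¹ : (ZMod q)ˣ) : ZMod q))) ^ n := by
    rw [← Equiv.sum_comp (Equiv.addRight (1 : ZMod q)), S]
    refine Finset.sum_bij' (fun u _ ↦ (u : ZMod q)) (fun u _ ↦ u.val) ?_ ?_ ?_ ?_ ?_
    · simp
    · simp [ZMod.val_lt]
    · intro u hu
      simpa using Nat.mod_eq_of_lt (Finset.mem_range.1 hu)
    · simp
    · intro u _
      simp [Kl_eq_sum_units]
  rw [h1]
  simp_rw [Fintype.sum_pow]
  rw [Finset.sum_comm, Finset.mul_sum]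
  refine Finset.sum_congr rfl fun f _ ↦ ?_
  have h2 (u : ZMod q) : ∏ i, stdAddChar (u * (f i : ZMod q) + (((f i)⁻¹ : (ZMod q)ˣ) : ZMod q))
      = stdAddChar (u * ∑ i, (f i : ZMod q)) *
        stdAddChar (∑ i, (((f i)⁻¹ : (ZMod q)ˣ) : ZMod q)) := by
    rw [← AddChar.map_add_eq_mul, Finset.mul_sum, ← Finset.sum_add_distrib]
    exact (map_sum stdAddChar.toAddMonoidHom _ _).symm
  simp_rw [h2]
  rw [← Finset.sum_mul, AddChar.sum_mulShift _ (isPrimitive_stdAddChar q)]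
  split_ifs <;> simp

/-- Scaling a tuple so that its first entry is `1`. -/
def unitsTupleEquiv (G : Type*) [Group G] (m : ℕ) : G × (Fin m → G) ≃ (Fin (m + 1) → G) where
  toFun z := Fin.cons z.1 fun i ↦ z.1 * z.2 i
  invFun f := (f 0, fun i ↦ (f 0)⁻¹ * f i.succ)
  left_inv z := by simp
  right_inv f := by
    ext i
    refine Fin.cases ?_ (fun i ↦ ?_) i <;> simp

open ZMod in
lemma S_succ_eq_sum (m q : ℕ) [NeZero q] :
    S (m + 1) q = q * ∑ g : Fin m → (ZMod q)ˣ, if ∑ i, (g i : ZMod q) + 1 = 0 then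
      ∑ a : (ZMod q)ˣ, stdAddChar
        ((a : ZMod q) * (∑ i, (((g i)⁻¹ : (ZMod q)ˣ) : ZMod q) + 1)) else 0 := by
  rw [S_eq_sum_filter, ← (unitsTupleEquiv (ZMod q)ˣ m).sum_comp, Fintype.sum_prod_type_right]
  congr 1
  refine Finset.sum_congr rfl fun g _ ↦ ?_
  have h1 (a : (ZMod q)ˣ) : ∑ i, ((unitsTupleEquiv (ZMod q)ˣ m (a, g) i : (ZMod q)ˣ) : ZMod q)
      = a * (∑ i, (g i : ZMod q) + 1) := by
    simp [unitsTupleEquiv, Fin.sum_univ_succ, mul_add, Finset.mul_sum, add_comm]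
  have h2 (a : (ZMod q)ˣ) :
      ∑ i, (((unitsTupleEquiv (ZMod q)ˣ m (a, g) i)⁻¹ : (ZMod q)ˣ) : ZMod q)
      = ((a⁻¹ : (ZMod q)ˣ) : ZMod q) * (∑ i, (((g i)⁻¹ : (ZMod q)ˣ) : ZMod q) + 1) := by
    simp [unitsTupleEquiv, Fin.sum_univ_succ, mul_add, Finset.mul_sum, add_comm, mul_comm]
  simp_rw [h1, h2, Units.mul_right_eq_zero]
  split_ifs
  · exact Equiv.sum_comp (Equiv.inv (ZMod q)ˣ) fun a : (ZMod q)ˣ ↦ stdAddChar ((a : ZMod q) * _)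
  · simp

lemma sum_units_add_sum_not_isUnit {R M : Type*} [Monoid R] [Fintype R] [Fintype Rˣ]
    [Fintype {x : R // ¬ IsUnit x}] [AddCommMonoid M] (f : R → M) :
    ∑ a : Rˣ, f a + ∑ x : {x : R // ¬ IsUnit x}, f x = ∑ x, f x := by
  classical
  rw [← Fintype.sum_subtype_add_sum_subtype (fun x ↦ IsUnit x) f]
  refine congrArg₂ (· + ·) (Fintype.sum_bijective
    (fun a : Rˣ ↦ (⟨a, a.isUnit⟩ : {x : R // IsUnit x})) ⟨?_, ?_⟩ _ _ fun _ ↦ rfl)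
    (by convert rfl)
  · intro a b h
    simpa [Units.ext_iff] using h
  · rintro ⟨x, hx⟩
    exact ⟨hx.unit, rfl⟩

/-- Lifting along `φ` solutions of a pair of equations in units, keeping the first equation. -/
lemma card_lift_units {A B : Type*} [CommRing A] [CommRing B] [Finite A] [Finite B]
    (φ : A →+* B) [IsLocalHom φ] {N : ℕ}
    (hN : ∀ b : Bˣ, Nat.card {u : Aˣ // Units.map (φ : A →* B) u = b} = N) (k : ℕ) :
    Nat.card {g : Fin (k + 1) → Aˣ // ∑ i, (g i : A) + 1 = 0 ∧
      φ (∑ i, (((g i)⁻¹ : Aˣ) : A) + 1) = 0} =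
    N ^ k * Nat.card {h : Fin (k + 1) → Bˣ // ∑ i, (h i : B) + 1 = 0 ∧
      ∑ i, (((h i)⁻¹ : Bˣ) : B) + 1 = 0} := by
  classical
  have := Fintype.ofFinite A
  have := Fintype.ofFinite B
  let F : {g : Fin (k + 1) → Aˣ // ∑ i, (g i : A) + 1 = 0 ∧
      φ (∑ i, (((g i)⁻¹ : Aˣ) : A) + 1) = 0} → {h : Fin (k + 1) → Bˣ // ∑ i, (h i : B) + 1 = 0 ∧
      ∑ i, (((h i)⁻¹ : Bˣ) : B) + 1 = 0} := fun g ↦ ⟨fun i ↦ Units.map (φ : A →* B) (g.1 i), by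
    have h1 := congrArg φ g.2.1
    have h2 := g.2.2
    simp only [map_add, map_sum, map_one, map_zero] at h1 h2
    exact ⟨by simpa using h1, by simpa [← map_inv] using h2⟩⟩
  have hF (h) : Nat.card {g // F g = h} = N ^ k := by
    have hpi :
        Nat.card (∀ i : Fin k, {u : Aˣ // Units.map (φ : A →* B) u = h.1 i.succ}) = N ^ k := by
      rw [Nat.card_pi, Finset.prod_congr rfl fun i _ ↦ hN _]
      simp
    rw [← hpi]
    refine Nat.card_eq_of_bijective (fun g i ↦ ⟨g.1.1 i.succ, congrFun (congrArg (·.1) g.2) i.succ⟩)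
      ⟨?_, ?_⟩
    · rintro ⟨⟨g, hg, _⟩, _⟩ ⟨⟨g', hg', _⟩, _⟩ hgg
      have htail (i : Fin k) : g i.succ = g' i.succ := congrArg (·.1) (congrFun hgg i)
      have h0 : g 0 = g' 0 := by
        rw [Fin.sum_univ_succ] at hg hg'
        simp_rw [htail] at hg
        ext
        linear_combination hg - hg'
      simp only [Subtype.mk.injEq]
      funext i
      exact Fin.cases h0 htail i
    · intro w
      have hφ : φ (-(∑ i, ((w i).1 : A) + 1)) = h.1 0 := by
        have h1 := h.2.1
        have hw (i : Fin k) : φ ((w i).1 : A) = h.1 i.succ := congrArg Units.val (w i).2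
        rw [Fin.sum_univ_succ] at h1
        simp only [map_neg, map_add, map_sum, map_one, hw]
        linear_combination -h1
      have hu : IsUnit (-(∑ i, ((w i).1 : A) + 1)) :=
        isUnit_of_map_unit φ _ (hφ ▸ (h.1 0).isUnit)
      let g : Fin (k + 1) → Aˣ := Fin.cons hu.unit fun i ↦ (w i).1
      have hg (i) : Units.map (φ : A →* B) (g i) = h.1 i := by
        refine Fin.cases (Units.ext hφ) (fun i ↦ (w i).2) i
      refine ⟨⟨⟨g, ?_, ?_⟩, Subtype.ext (funext hg)⟩, rfl⟩
      · simp [g, Fin.sum_univ_succ]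
      · have hg' (i) : φ (((g i)⁻¹ : Aˣ) : A) = (((h.1 i)⁻¹ : Bˣ) : B) := by
          rw [← hg i, ← map_inv]
          rfl
        simpa only [map_add, map_sum, map_one, hg'] using h.2.2
  rw [← Nat.card_congr (Equiv.sigmaFiberEquiv F), Nat.card_sigma,
    Finset.sum_congr rfl fun h _ ↦ hF h]
  simp [mul_comm]

section PrimePower

variable {p s : ℕ}

lemma castHom_eq_zero_iff_prime_mul (hp : p.Prime) (t : ZMod (p ^ (s + 1))) :
    ZMod.castHom (pow_dvd_pow p s.le_succ) (ZMod (p ^ s)) t = 0 ↔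
      (p : ZMod (p ^ (s + 1))) * t = 0 := by
  have : NeZero p := ⟨hp.ne_zero⟩
  obtain ⟨t, rfl⟩ := ZMod.natCast_zmod_surjective t
  rw [map_natCast, ← Nat.cast_mul, ZMod.natCast_eq_zero_iff, ZMod.natCast_eq_zero_iff, pow_succ',
    Nat.mul_dvd_mul_iff_left hp.pos]

lemma mem_span_prime_iff_not_isUnit (hp : p.Prime) (x : ZMod (p ^ (s + 1))) :
    x ∈ Ideal.span {(p : ZMod (p ^ (s + 1)))} ↔ ¬ IsUnit x := by
  have : NeZero p := ⟨hp.ne_zero⟩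
  obtain ⟨x, rfl⟩ := ZMod.natCast_zmod_surjective x
  rw [ZMod.isUnit_iff_coprime, Nat.coprime_pow_right_iff s.succ_pos, Nat.coprime_comm,
    hp.coprime_iff_not_dvd, not_not, Ideal.mem_span_singleton]
  refine ⟨?_, fun h ↦ by exact_mod_cast Nat.cast_dvd_cast h⟩
  rintro ⟨c, hc⟩
  have h := congrArg (ZMod.castHom (dvd_pow_self p s.succ_ne_zero) (ZMod p)) hc
  simpa [-ZMod.castHom_apply, ZMod.natCast_eq_zero_iff] using h

lemma card_span_prime (hp : p.Prime) :
    Nat.card (Ideal.span {(p : ZMod (p ^ (s + 1)))}) = p ^ s := by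
  classical
  have : NeZero p := ⟨hp.ne_zero⟩
  have h := sum_units_add_sum_not_isUnit fun _ : ZMod (p ^ (s + 1)) ↦ 1
  simp only [Finset.sum_const, Finset.card_univ, smul_eq_mul, mul_one, ZMod.card,
    ZMod.card_units_eq_totient, Nat.totient_prime_pow_succ hp] at h
  have h' : Nat.card (Ideal.span {(p : ZMod (p ^ (s + 1)))}) =
      Fintype.card {x : ZMod (p ^ (s + 1)) // ¬ IsUnit x} := by
    rw [← Nat.card_eq_fintype_card]
    exact Nat.card_congr (Equiv.subtypeEquivRight (mem_span_prime_iff_not_isUnit hp))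
  rw [h']
  have hsplit : p ^ s * (p - 1) + p ^ s = p ^ (s + 1) := by
    rw [← Nat.mul_succ, Nat.succ_eq_add_one, Nat.sub_add_cancel hp.one_le, pow_succ]
  omega

open ZMod in
/-- Evaluation of the Ramanujan sum modulo a prime power. -/
lemma sum_units_stdAddChar (hp : p.Prime) [NeZero p] (t : ZMod (p ^ (s + 1))) :
    ∑ a : (ZMod (p ^ (s + 1)))ˣ, stdAddChar ((a : ZMod (p ^ (s + 1))) * t) =
      (if t = 0 then (p : ℂ) ^ (s + 1) else 0) -
      if castHom (pow_dvd_pow p s.le_succ) (ZMod (p ^ s)) t = 0 then (p : ℂ) ^ s else 0 := by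
  classical
  let I := Ideal.span {(p : ZMod (p ^ (s + 1)))}
  let χ : AddChar I ℂ := (AddChar.mulShift stdAddChar t).compAddMonoidHom I.toAddSubgroup.subtype
  have hχ (x : I) : χ x = stdAddChar ((x : ZMod (p ^ (s + 1))) * t) := by
    simp only [χ, AddChar.compAddMonoidHom_apply, AddChar.mulShift_apply, mul_comm t]
    rfl
  have hχ0 : χ = 0 ↔ castHom (pow_dvd_pow p s.le_succ) (ZMod (p ^ s)) t = 0 := by
    rw [castHom_eq_zero_iff_prime_mul hp, AddChar.eq_zero_iff]
    simp_rw [hχ]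
    constructor
    · intro h
      by_contra h0
      refine isPrimitive_stdAddChar _ h0 ?_
      ext y
      simpa [mul_assoc, mul_comm, mul_left_comm] using
        h ⟨p * y, Ideal.mul_mem_right _ _ (Ideal.mem_span_singleton_self _)⟩
    · rintro h ⟨x, hx⟩
      obtain ⟨y, rfl⟩ := Ideal.mem_span_singleton.1 hx
      rw [mul_right_comm, h, zero_mul, AddChar.map_zero_eq_one]
  have hI : ∑ x : I, stdAddChar ((x : ZMod (p ^ (s + 1))) * t) =
      if castHom (pow_dvd_pow p s.le_succ) (ZMod (p ^ s)) t = 0 then (p : ℂ) ^ s else 0 := by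
    have h := χ.sum_eq_ite
    simp_rw [hχ, hχ0] at h
    rw [h, ← Nat.card_eq_fintype_card, card_span_prime hp, Nat.cast_pow]
  have hN : ∑ x : {x : ZMod (p ^ (s + 1)) // ¬ IsUnit x},
      stdAddChar ((x : ZMod (p ^ (s + 1))) * t) =
      ∑ x : I, stdAddChar ((x : ZMod (p ^ (s + 1))) * t) :=
    Fintype.sum_equiv (Equiv.subtypeEquivRight fun x ↦ (mem_span_prime_iff_not_isUnit hp x).symm)
      _ _ fun _ ↦ rfl
  rw [eq_sub_iff_add_eq, ← hI, ← hN,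
    sum_units_add_sum_not_isUnit fun x ↦ stdAddChar (x * t),
    AddChar.sum_mulShift t (isPrimitive_stdAddChar (p ^ (s + 1))), ZMod.card, Nat.cast_ite,
    Nat.cast_pow, Nat.cast_zero]

lemma card_unitsMap_fiber (hp : p.Prime) (hs : s ≠ 0) (b : (ZMod (p ^ s))ˣ) :
    Nat.card {u // ZMod.unitsMap (pow_dvd_pow p s.le_succ) u = b} = p := by
  have : NeZero p := ⟨hp.ne_zero⟩
  have hsurj := ZMod.unitsMap_surjective (pow_dvd_pow p s.le_succ)
  have h1 : Nat.card {u // ZMod.unitsMap (pow_dvd_pow p s.le_succ) u = b} =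
      Nat.card (ZMod.unitsMap (pow_dvd_pow p s.le_succ)).ker :=
    Nat.card_congr (MonoidHom.fiberEquivKerOfSurjective hsurj b)
  have h2 := (ZMod.unitsMap (pow_dvd_pow p s.le_succ)).ker.card_mul_index
  rw [Subgroup.index_ker, MonoidHom.range_eq_top.2 hsurj, Subgroup.card_top,
    Nat.card_eq_fintype_card (α := (ZMod (p ^ s))ˣ),
    Nat.card_eq_fintype_card (α := (ZMod (p ^ (s + 1)))ˣ), ZMod.card_units_eq_totient,
    ZMod.card_units_eq_totient, Nat.totient_prime_pow_succ hp,
    Nat.totient_prime_pow hp (Nat.pos_of_ne_zero hs)] at h2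
  rw [h1]
  generalize Nat.card (ZMod.unitsMap (pow_dvd_pow p s.le_succ)).ker = c at h2 ⊢
  rw [← mul_pow_sub_one hs p, mul_assoc] at h2
  exact Nat.eq_of_mul_eq_mul_right
    (Nat.mul_pos (pow_pos hp.pos _) (Nat.sub_pos_of_lt hp.one_lt)) h2

lemma isLocalHom_castHom_prime_pow (hp : p.Prime) (hs : s ≠ 0) :
    IsLocalHom (ZMod.castHom (pow_dvd_pow p s.le_succ) (ZMod (p ^ s))) := by
  have : NeZero p := ⟨hp.ne_zero⟩
  refine ⟨fun x hx ↦ ?_⟩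
  obtain ⟨x, rfl⟩ := ZMod.natCast_zmod_surjective x
  rw [map_natCast, ZMod.isUnit_iff_coprime, Nat.coprime_pow_right_iff (Nat.pos_of_ne_zero hs)] at hx
  rwa [ZMod.isUnit_iff_coprime, Nat.coprime_pow_right_iff s.succ_pos]

end PrimePower

/-- For `n ≥ 2`, `p` prime and `r ≥ 2`, with `q = p^r`:
`S_n(q) = q²·W_n(q) − q²·p^(n-3)·W_n(q/p)`. -/
theorem power_moment_eq_W (n p r : ℕ) (hn : 2 ≤ n) (hp : p.Prime) (hr : 2 ≤ r) :
    S n (p ^ r) =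
      (p : ℂ) ^ (2 * r) * (W n (p ^ r) : ℂ)
        - (p : ℂ) ^ (2 * r) * (p : ℂ) ^ ((n : ℤ) - 3) * (W n (p ^ (r - 1)) : ℂ) := by
  obtain ⟨k, rfl⟩ := Nat.exists_eq_add_of_le' hn
  obtain ⟨s, rfl⟩ := Nat.exists_eq_add_of_le' (one_le_two.trans hr)
  have hs : s ≠ 0 := by omega
  have : NeZero p := ⟨hp.ne_zero⟩
  have hp0 : (p : ℂ) ≠ 0 := Nat.cast_ne_zero.2 hp.ne_zero
  have := isLocalHom_castHom_prime_pow hp hs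
  have hW (q : ℕ) : W (k + 2) q = Nat.card {x : Fin (k + 1) → (ZMod q)ˣ //
      ∑ i, (x i : ZMod q) + 1 = 0 ∧ ∑ i, (((x i)⁻¹ : (ZMod q)ˣ) : ZMod q) + 1 = 0} := rfl
  have hlift : Nat.card {g : Fin (k + 1) → (ZMod (p ^ (s + 1)))ˣ //
      ∑ i, (g i : ZMod (p ^ (s + 1))) + 1 = 0 ∧
        ZMod.castHom (pow_dvd_pow p s.le_succ) (ZMod (p ^ s))
          (∑ i, (((g i)⁻¹ : (ZMod (p ^ (s + 1)))ˣ) : ZMod (p ^ (s + 1))) + 1) = 0} =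
      p ^ k * W (k + 2) (p ^ s) :=
    card_lift_units (ZMod.castHom (pow_dvd_pow p s.le_succ) (ZMod (p ^ s)))
      (card_unitsMap_fiber hp hs) k
  have hexp : (p : ℂ) ^ (((k + 2 : ℕ) : ℤ) - 3) = (p : ℂ) ^ k / p := by
    rw [← zpow_natCast, div_eq_mul_inv, ← zpow_sub_one₀ hp0]
    push_cast
    ring_nf
  rw [Nat.add_sub_cancel, hexp, S_succ_eq_sum]
  simp_rw [sum_units_stdAddChar hp]
  have hsplit (P Q T : Prop) [Decidable P] [Decidable Q] [Decidable T] (a b : ℂ) :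
      (if P then (if Q then a else 0) - (if T then b else 0) else 0) =
        a * (if P ∧ Q then 1 else 0) - b * (if P ∧ T then 1 else 0) := by
    split_ifs <;> simp_all
  simp_rw [hsplit]
  rw [Finset.sum_sub_distrib, ← Finset.mul_sum, ← Finset.mul_sum, Finset.sum_boole,
    Finset.sum_boole, ← Fintype.card_subtype, ← Fintype.card_subtype, ← Nat.card_eq_fintype_card,
    ← Nat.card_eq_fintype_card, ← hW, hlift]
  push_cast
  field_simp
  ring
end

section
/- Let n ≥ 2 be an integer, p a prime, and k ≥ 1 an integer. Then V_n(p^k) = φ(p^k)·W_n(p^k), where φ is Euler's totient function. -/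
open Finset

/-- `V_n(q)`: number of tuples `(x_1,…,x_{n-1})` of units mod `q` with
`(x_1+⋯+x_{n-1})·(x_1⁻¹+⋯+x_{n-1}⁻¹) ≡ 1 (mod q)`. -/
noncomputable def V (n q : ℕ) : ℕ :=
  Nat.card {x : Fin (n - 1) → (ZMod q)ˣ //
    (∑ i, ((x i : ZMod q))) * (∑ i, (((x i)⁻¹ : (ZMod q)ˣ) : ZMod q)) = 1}

/-- Over any commutative ring, a tuple of units with `(∑ x) * (∑ x⁻¹) = 1` is uniquely a unit times
a tuple of units `y` with `∑ y = ∑ y⁻¹ = -1`. -/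
def sumMulSumInvEquiv (R ι : Type*) [CommRing R] [Fintype ι] :
    {x : ι → Rˣ // (∑ i, (x i : R)) * (∑ i, (((x i)⁻¹ : Rˣ) : R)) = 1} ≃
      Rˣ × {x : ι → Rˣ // (∑ i, (x i : R)) + 1 = 0 ∧ (∑ i, (((x i)⁻¹ : Rˣ) : R)) + 1 = 0} where
  toFun x :=
    let u : Rˣ := -Units.mkOfMulEqOne _ _ x.2
    (u, ⟨fun i => u⁻¹ * x.1 i, by
      have hu : (∑ i, (x.1 i : R)) = -(u : R) := by simp [u]
      have hx := x.2
      rw [hu] at hx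
      constructor
      · simp only [Units.val_mul, ← Finset.mul_sum, hu, mul_neg, Units.inv_mul, neg_add_cancel]
      · simp only [mul_inv, inv_inv, Units.val_mul, ← Finset.mul_sum]
        linear_combination -hx⟩)
  invFun y := ⟨fun i => y.1 * y.2.1 i, by
    have h₁ := eq_neg_of_add_eq_zero_left y.2.2.1
    have h₂ := eq_neg_of_add_eq_zero_left y.2.2.2
    simp only [mul_inv, Units.val_mul, ← Finset.mul_sum, h₁, h₂]
    simp⟩
  left_inv x := by
    ext i
    simp
  right_inv y := by
    have h₁ := eq_neg_of_add_eq_zero_left y.2.2.1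
    have key : ∀ h, -Units.mkOfMulEqOne (∑ i, ((y.1 * y.2.1 i : Rˣ) : R))
        (∑ i, (((y.1 * y.2.1 i)⁻¹ : Rˣ) : R)) h = y.1 := by
      intro h
      ext
      simp [← Finset.mul_sum, h₁]
    refine Prod.ext (key _) (Subtype.ext (funext fun i => ?_))
    dsimp only
    rw [key, inv_mul_cancel_left]

/-- For `n ≥ 2`, `p` prime and `k ≥ 1`: `V_n(p^k) = φ(p^k)·W_n(p^k)`. -/
theorem V_eq_totient_mul_W (n p k : ℕ) (hn : 2 ≤ n) (hp : p.Prime) (hk : 1 ≤ k) :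
    V n (p ^ k) = Nat.totient (p ^ k) * W n (p ^ k) := by
  have : NeZero (p ^ k) := ⟨pow_ne_zero k hp.ne_zero⟩
  unfold V W
  rw [Nat.card_congr (sumMulSumInvEquiv (ZMod (p ^ k)) (Fin (n - 1))), Nat.card_prod,
    Nat.card_eq_fintype_card, ZMod.card_units_eq_totient]
end

section
/- Let n ≥ 3 and p both be odd, with n an integer, p a prime, and p² > n. Then S_n(p^r) = 0 for every integer r ≥ 3, and S_n(p²) = −p^{n+1}·Σ C(n−2, i), where the sum runs over all integers i with 0 ≤ i ≤ n−2 such that 2(i+1) ≡ n (mod p) or 2(i+1) ≡ n−2 (mod p), and C(a,b) denotes the binomial coefficient. -/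
open Finset

/-- The Kloosterman sum `∑ ψ(u x + x⁻¹)` over the units `x` of `ℤ/qℤ`, where `ψ` is the standard
additive character. -/
noncomputable def kloosterman {q : ℕ} [NeZero q] (u : ZMod q) : ℂ :=
  ∑ x : (ZMod q)ˣ, ZMod.stdAddChar (u * (x : ZMod q) + ((x⁻¹ : (ZMod q)ˣ) : ZMod q))

lemma sum_range_eq_sum_zmod {q : ℕ} [NeZero q] (f : ZMod q → ℂ) :
    ∑ x ∈ range q, f (x : ZMod q) = ∑ x : ZMod q, f x := by
  refine sum_bij' (fun x _ => (x : ZMod q)) (fun x _ => x.val) ?_ ?_ ?_ ?_ ?_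
  · simp
  · intro x _
    simpa using ZMod.val_lt x
  · intro x hx
    exact ZMod.val_cast_of_lt (mem_range.1 hx)
  · simp
  · simp

lemma sum_units_eq_sum_filter {R : Type*} [CommRing R] [Fintype R] [DecidableEq R]
    [DecidablePred (IsUnit : R → Prop)] (f : R → ℂ) :
    ∑ x : Rˣ, f x = ∑ x with IsUnit x, f x := by
  refine sum_bij (fun x _ => (x : R)) ?_ ?_ ?_ ?_
  · simp
  · intro x _ y _ h
    exact Units.ext h
  · intro x hx
    obtain ⟨y, rfl⟩ := (mem_filter.1 hx).2
    exact ⟨y, mem_univ _, rfl⟩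
  · simp

lemma Kl_one_eq_kloosterman {q : ℕ} [NeZero q] (u : ℤ) :
    Kl q u 1 = kloosterman (u : ZMod q) := by
  classical
  have key : Kl q u 1 = ∑ x ∈ range q, (fun y : ZMod q =>
      if IsUnit y then ZMod.stdAddChar ((u : ZMod q) * y + y⁻¹) else 0) (x : ZMod q) := by
    refine sum_congr rfl fun x _ => ?_
    simp only [ZMod.isUnit_iff_coprime]
    split_ifs with h
    · have : ((u : ZMod q) * x + (x : ZMod q)⁻¹) =
          ((u * x + ((x : ZMod q)⁻¹).val : ℤ) : ZMod q) := by
        push_cast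
        rw [ZMod.natCast_zmod_val]
      rw [this, ZMod.stdAddChar_coe]
      push_cast
      rw [one_mul]
    · rfl
  rw [key.trans (sum_range_eq_sum_zmod fun y : ZMod q =>
      if IsUnit y then ZMod.stdAddChar ((u : ZMod q) * y + y⁻¹) else 0), ← sum_filter,
    ← sum_units_eq_sum_filter
    (fun y : ZMod q => (ZMod.stdAddChar ((u : ZMod q) * y + y⁻¹) : ℂ))]
  simp [kloosterman, ZMod.inv_coe_unit]

lemma S_eq_sum_kloosterman (n q : ℕ) [NeZero q] :
    S n q = ∑ u : ZMod q, kloosterman u ^ n := by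
  rw [← Equiv.sum_comp (Equiv.addRight (1 : ZMod q)), ← sum_range_eq_sum_zmod]
  simp [S, Kl_one_eq_kloosterman]

lemma sum_stdAddChar_mul {q : ℕ} [NeZero q] (b : ZMod q) :
    ∑ z : ZMod q, (ZMod.stdAddChar (z * b) : ℂ) = if b = 0 then (q : ℂ) else 0 := by
  rw [AddChar.sum_mulShift b (ZMod.isPrimitive_stdAddChar q), ZMod.card]
  split_ifs <;> simp

/-- Averaging over the translations `x ↦ x (1 + c z)` with `c` nilpotent. -/
lemma sum_units_eq_sum_stationary {q : ℕ} [NeZero q] {c : ZMod q} (hc : IsNilpotent c)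
    (F : (ZMod q)ˣ → ℂ) (g : (ZMod q)ˣ → ZMod q)
    (h : ∀ (x y : (ZMod q)ˣ) (z : ZMod q), (y : ZMod q) = x * (1 + c * z) →
      F y = F x * ZMod.stdAddChar (z * g x)) :
    ∑ x, F x = ∑ x with g x = 0, F x := by
  have hu (z : ZMod q) : IsUnit (1 + c * z) :=
    (Commute.isNilpotent_mul_right (Commute.all _ _) hc).isUnit_one_add
  have shift (z : ZMod q) : ∑ x, F x = ∑ x, F x * ZMod.stdAddChar (z * g x) := by
    rw [← Equiv.sum_comp (Equiv.mulRight (hu z).unit)]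
    exact sum_congr rfl fun x _ => h _ _ _ (by simp)
  have hq : (q : ℂ) ≠ 0 := by exact_mod_cast NeZero.ne q
  apply mul_left_cancel₀ hq
  calc (q : ℂ) * ∑ x, F x = ∑ z : ZMod q, ∑ x, F x := by simp
    _ = ∑ z : ZMod q, ∑ x, F x * ZMod.stdAddChar (z * g x) :=
        sum_congr rfl fun z _ => shift z
    _ = ∑ x, F x * (if g x = 0 then (q : ℂ) else 0) := by
        rw [sum_comm]
        exact sum_congr rfl fun x _ => by rw [← mul_sum, sum_stdAddChar_mul]
    _ = (q : ℂ) * ∑ x with g x = 0, F x := by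
        rw [sum_filter, mul_sum]
        refine sum_congr rfl fun x _ => ?_
        split_ifs <;> ring

lemma prime_pow_succ_eq_zero (p a : ℕ) : (p : ZMod (p ^ (a + 1))) ^ (a + 1) = 0 := by
  exact_mod_cast ZMod.natCast_self (p ^ (a + 1))

lemma isUnit_two_of_odd {p : ℕ} (hodd : Odd p) (a : ℕ) : IsUnit (2 : ZMod (p ^ a)) := by
  have : IsUnit ((2 : ℕ) : ZMod (p ^ a)) := by
    rw [ZMod.isUnit_iff_coprime]
    exact (Nat.coprime_two_left.2 hodd).pow_right a
  exact_mod_cast this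

/-- A residue congruent to `1` modulo an odd prime `p` is a square modulo every power of `p`. -/
lemma exists_unit_sq_eq_of_prime_dvd_sub_one {p : ℕ} (hodd : Odd p) (a : ℕ)
    (z : (ZMod (p ^ (a + 1)))ˣ)
    (hz : (p : ZMod (p ^ (a + 1))) ∣ (z : ZMod (p ^ (a + 1))) - 1) :
    ∃ w : (ZMod (p ^ (a + 1)))ˣ, w ^ 2 = z := by
  have h := dvd_sub_pow_of_dvd_sub hz (a := (z : ZMod (p ^ (a + 1)))) a
  rw [prime_pow_succ_eq_zero, zero_dvd_iff, one_pow, sub_eq_zero] at h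
  obtain ⟨m, hm⟩ := hodd.pow (n := a)
  have h' : z ^ (2 * m + 1) = 1 := Units.ext (by rw [← hm]; simpa using h)
  refine ⟨(z ^ m)⁻¹, ?_⟩
  rw [inv_pow, inv_eq_iff_mul_eq_one, ← pow_mul, mul_comm m 2, ← pow_succ, h']

lemma not_sq_dvd_two_mul {p : ℕ} (hodd : Odd p) {m n : ℕ} (hn : Odd n)
    (hnp : n < p ^ 2) (hm : m ≤ n) : ¬ (p : ℤ) ^ 2 ∣ 2 * (2 * m - n) := by
  intro h
  have hcop : IsCoprime ((p : ℤ) ^ 2) 2 := by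
    have := (Nat.coprime_two_right.2 hodd).pow_left 2
    exact_mod_cast Nat.isCoprime_iff_coprime.2 this
  have h1 := hcop.dvd_of_dvd_mul_left h
  have h2 : (2 * m - n : ℤ) = 0 := by
    apply Int.eq_zero_of_abs_lt_dvd h1
    rw [abs_lt]
    zify at hnp hm
    constructor <;> linarith
  obtain ⟨j, hj⟩ := hn
  omega

section PrimePower

variable {p : ℕ} [hp : Fact p.Prime]

lemma prime_pow_mul_eq_zero_iff (a b : ℕ) (d : ℤ) :
    ((p : ZMod (p ^ (a + b))) ^ a * (d : ZMod (p ^ (a + b)))) = 0 ↔ (p : ℤ) ^ b ∣ d := by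
  have : (p : ZMod (p ^ (a + b))) ^ a * (d : ZMod (p ^ (a + b))) =
      (((p : ℤ) ^ a * d : ℤ) : ZMod (p ^ (a + b))) := by push_cast; rfl
  rw [this, ZMod.intCast_zmod_eq_zero_iff_dvd]
  push_cast
  rw [pow_add]
  exact mul_dvd_mul_iff_left (pow_ne_zero _ (by exact_mod_cast hp.out.ne_zero))

lemma prime_dvd_iff_int (a : ℕ) (d : ℤ) :
    (p : ZMod (p ^ (a + 1))) ∣ d ↔ (p : ℤ) ∣ d := by
  constructor
  · rintro ⟨c, hc⟩
    have := prime_pow_mul_eq_zero_iff (p := p) a 1 d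
    rw [pow_one] at this
    rw [← this, hc, ← mul_assoc, ← pow_succ, prime_pow_succ_eq_zero, zero_mul]
  · rintro ⟨c, rfl⟩
    exact ⟨c, by push_cast; rfl⟩

lemma prime_pow_mul_eq_zero_iff_dvd (a : ℕ) (d : ZMod (p ^ (a + 1))) :
    (p : ZMod (p ^ (a + 1))) ^ a * d = 0 ↔ (p : ZMod (p ^ (a + 1))) ∣ d := by
  obtain ⟨d, rfl⟩ := ZMod.intCast_surjective d
  rw [prime_pow_mul_eq_zero_iff, prime_dvd_iff_int, pow_one]

lemma isUnit_iff_not_prime_dvd (a : ℕ) (d : ZMod (p ^ (a + 1))) :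
    IsUnit d ↔ ¬ (p : ZMod (p ^ (a + 1))) ∣ d := by
  obtain ⟨d, rfl⟩ := ZMod.natCast_zmod_surjective d
  have := prime_dvd_iff_int (p := p) a d
  rw [Int.cast_natCast, Int.natCast_dvd_natCast] at this
  rw [ZMod.isUnit_natCast_iff_not_dvd_pow hp.out a.succ_pos, this]

lemma prime_dvd_mul_iff (a : ℕ) (c d : ZMod (p ^ (a + 1))) :
    (p : ZMod (p ^ (a + 1))) ∣ c * d ↔
      (p : ZMod (p ^ (a + 1))) ∣ c ∨ (p : ZMod (p ^ (a + 1))) ∣ d := by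
  have h := isUnit_iff_not_prime_dvd (p := p) a
  have h1 := h (c * d)
  rw [IsUnit.mul_iff, h, h] at h1
  tauto

lemma not_prime_dvd_unit (a : ℕ) (x : (ZMod (p ^ (a + 1)))ˣ) :
    ¬ (p : ZMod (p ^ (a + 1))) ∣ x :=
  (isUnit_iff_not_prime_dvd a _).1 x.isUnit

lemma kloosterman_eq_sum_stationary (k : ℕ) (u : ZMod (p ^ (k + 1 + 1))) :
    kloosterman u = ∑ x ∈ univ.filter fun x : (ZMod (p ^ (k + 1 + 1)))ˣ =>
      (p : ZMod (p ^ (k + 1 + 1))) ∣ u * (x : ZMod (p ^ (k + 1 + 1))) ^ 2 - 1,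
      ZMod.stdAddChar (u * (x : ZMod (p ^ (k + 1 + 1))) +
        ((x⁻¹ : (ZMod (p ^ (k + 1 + 1)))ˣ) : ZMod (p ^ (k + 1 + 1)))) := by
  have hsq : (p : ZMod (p ^ (k + 1 + 1))) ^ (k + 1) *
      (p : ZMod (p ^ (k + 1 + 1))) ^ (k + 1) = 0 := by
    have h0 := prime_pow_succ_eq_zero p (k + 1)
    linear_combination (p : ZMod (p ^ (k + 1 + 1))) ^ k * h0
  rw [kloosterman, sum_units_eq_sum_stationary (c := (p : ZMod (p ^ (k + 1 + 1))) ^ (k + 1))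
    ⟨2, by rw [sq, hsq]⟩ _ (fun x => (p : ZMod (p ^ (k + 1 + 1))) ^ (k + 1) *
      (u * (x : ZMod (p ^ (k + 1 + 1))) -
        ((x⁻¹ : (ZMod (p ^ (k + 1 + 1)))ˣ) : ZMod (p ^ (k + 1 + 1)))))]
  · refine sum_congr (filter_congr fun x _ => ?_) fun _ _ => rfl
    rw [prime_pow_mul_eq_zero_iff_dvd, ← Units.dvd_mul_right (u := x), sub_mul, x.inv_mul]
    ring_nf
  · intro x y z hy
    rw [← AddChar.map_add_eq_mul]
    congr 1
    have hx := x.mul_inv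
    set π := (p : ZMod (p ^ (k + 1 + 1))) ^ (k + 1)
    have hyinv : ((y⁻¹ : (ZMod (p ^ (k + 1 + 1)))ˣ) : ZMod (p ^ (k + 1 + 1))) =
        ((x⁻¹ : (ZMod (p ^ (k + 1 + 1)))ˣ) : ZMod (p ^ (k + 1 + 1))) * (1 - π * z) := by
      rw [Units.inv_eq_of_mul_eq_one_right]
      rw [hy]
      linear_combination (1 - π * z) * (1 + π * z) * hx - z ^ 2 * hsq
    rw [hyinv, hy]
    ring

/-- The part of the Kloosterman sum `∑ ψ(w (x + x⁻¹))` coming from `x ≡ 1` modulo `p`. -/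
noncomputable def kloostermanNearOne (k : ℕ) (w : ZMod (p ^ (k + 1 + 1))) : ℂ :=
    ∑ x ∈ univ.filter fun x : (ZMod (p ^ (k + 1 + 1)))ˣ =>
    (p : ZMod (p ^ (k + 1 + 1))) ∣ (x : ZMod (p ^ (k + 1 + 1))) - 1,
    ZMod.stdAddChar (w * ((x : ZMod (p ^ (k + 1 + 1))) +
      ((x⁻¹ : (ZMod (p ^ (k + 1 + 1)))ˣ) : ZMod (p ^ (k + 1 + 1)))))

lemma kloosterman_sq (hodd : Odd p) (k : ℕ) (w : (ZMod (p ^ (k + 1 + 1)))ˣ) :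
    kloosterman ((w : ZMod (p ^ (k + 1 + 1))) ^ 2) =
      kloostermanNearOne k (w : ZMod (p ^ (k + 1 + 1))) +
        kloostermanNearOne k (-(w : ZMod (p ^ (k + 1 + 1)))) := by
  classical
  have hw := w.mul_inv
  rw [kloosterman_eq_sum_stationary, kloostermanNearOne, kloostermanNearOne, sum_filter, sum_filter,
    sum_filter, ← Equiv.sum_comp (Equiv.mulLeft w⁻¹),
    ← Equiv.sum_comp (Equiv.neg _) (fun x : (ZMod (p ^ (k + 1 + 1)))ˣ =>
      if (p : ZMod (p ^ (k + 1 + 1))) ∣ (x : ZMod (p ^ (k + 1 + 1))) - 1 then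
        (ZMod.stdAddChar (-(w : ZMod (p ^ (k + 1 + 1))) * ((x : ZMod (p ^ (k + 1 + 1))) +
          ((x⁻¹ : (ZMod (p ^ (k + 1 + 1)))ˣ) : ZMod (p ^ (k + 1 + 1))))) : ℂ) else 0),
    ← sum_add_distrib]
  refine sum_congr rfl fun x _ => ?_
  simp only [Equiv.coe_mulLeft, Equiv.neg_apply, mul_inv_rev, inv_inv, inv_neg, Units.val_neg,
    Units.val_mul]
  set W := (w : ZMod (p ^ (k + 1 + 1)))
  set X := (x : ZMod (p ^ (k + 1 + 1)))
  set W' := ((w⁻¹ : (ZMod (p ^ (k + 1 + 1)))ˣ) : ZMod (p ^ (k + 1 + 1)))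
  set X' := ((x⁻¹ : (ZMod (p ^ (k + 1 + 1)))ˣ) : ZMod (p ^ (k + 1 + 1)))
  have e1 : W ^ 2 * (W' * X) ^ 2 - 1 = (X - 1) * (X + 1) := by
    linear_combination X ^ 2 * (W * W' + 1) * hw
  have e2 : W ^ 2 * (W' * X) + X' * W = W * (X + X') := by
    linear_combination W * X * hw
  have e3 : -W * (-X + -X') = W * (X + X') := by ring
  have e4 : -X - 1 = -(X + 1) := by ring
  rw [e1, e2, e3, e4]
  simp only [dvd_neg, prime_dvd_mul_iff]
  by_cases h1 : (p : ZMod (p ^ (k + 1 + 1))) ∣ X - 1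
  · have h2 : ¬ (p : ZMod (p ^ (k + 1 + 1))) ∣ X + 1 := by
      intro h2
      have h3 := dvd_sub h2 h1
      have e5 : X + 1 - (X - 1) = 2 := by ring
      rw [e5] at h3
      exact (isUnit_iff_not_prime_dvd (k + 1) _).1 (isUnit_two_of_odd hodd _) h3
    simp [h1, h2]
  · simp [h1]

lemma exists_sq_eq_of_kloosterman_ne_zero (hodd : Odd p) (k : ℕ) (u : ZMod (p ^ (k + 1 + 1)))
    (h : kloosterman u ≠ 0) :
    ∃ w : (ZMod (p ^ (k + 1 + 1)))ˣ, (w : ZMod (p ^ (k + 1 + 1))) ^ 2 = u := by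
  rw [kloosterman_eq_sum_stationary] at h
  obtain ⟨x, hx, -⟩ := exists_ne_zero_of_sum_ne_zero h
  replace hx := (mem_filter.1 hx).2
  have hz : IsUnit (u * (x : ZMod (p ^ (k + 1 + 1))) ^ 2) := by
    rw [isUnit_iff_not_prime_dvd]
    intro h1
    have h2 := dvd_sub h1 hx
    rw [sub_sub_cancel] at h2
    exact not_prime_dvd_unit (k + 1) 1 (by simpa using h2)
  obtain ⟨z, hz⟩ := hz
  rw [← hz] at hx
  obtain ⟨w, hw⟩ := exists_unit_sq_eq_of_prime_dvd_sub_one hodd _ z hx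
  refine ⟨w * x⁻¹, ?_⟩
  have hw' := congrArg (Units.val) hw
  rw [Units.val_pow_eq_pow_val, hz] at hw'
  have hxi := x.mul_inv
  rw [Units.val_mul, mul_pow, hw', mul_assoc, ← mul_pow, hxi, one_pow, mul_one]

lemma sum_units_kloosterman_sq (hodd : Odd p) (k : ℕ) {n : ℕ} (hn : n ≠ 0) :
    ∑ w : (ZMod (p ^ (k + 1 + 1)))ˣ, kloosterman ((w : ZMod (p ^ (k + 1 + 1))) ^ 2) ^ n =
      2 * ∑ u : ZMod (p ^ (k + 1 + 1)), kloosterman u ^ n := by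
  classical
  have h2 := (isUnit_iff_not_prime_dvd (k + 1) _).1 (isUnit_two_of_odd hodd (k + 1 + 1))
  rw [← sum_fiberwise' univ (fun w : (ZMod (p ^ (k + 1 + 1)))ˣ => (w : ZMod (p ^ (k + 1 + 1))) ^ 2)
    (fun u => kloosterman u ^ n), mul_sum]
  refine sum_congr rfl fun u _ => ?_
  rw [sum_const, nsmul_eq_mul]
  by_cases hu : kloosterman u = 0
  · simp [hu, hn]
  obtain ⟨w, rfl⟩ := exists_sq_eq_of_kloosterman_ne_zero hodd k u hu
  have h2w : ¬ (p : ZMod (p ^ (k + 1 + 1))) ∣ 2 * w := by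
    rw [prime_dvd_mul_iff]
    exact not_or.2 ⟨h2, not_prime_dvd_unit _ w⟩
  have hfib : ({v | (v : ZMod (p ^ (k + 1 + 1))) ^ 2 = (w : ZMod (p ^ (k + 1 + 1))) ^ 2} :
      Finset (ZMod (p ^ (k + 1 + 1)))ˣ) = {w, -w} := by
    ext v
    simp only [mem_filter, mem_univ, true_and, mem_insert, mem_singleton]
    constructor
    · intro hv
      have hprod : ((v : ZMod (p ^ (k + 1 + 1))) - w) * ((v : ZMod (p ^ (k + 1 + 1))) + w) = 0 := by
        linear_combination hv
      by_cases hd : (p : ZMod (p ^ (k + 1 + 1))) ∣ (v : ZMod (p ^ (k + 1 + 1))) - w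
      · left
        have hs : IsUnit ((v : ZMod (p ^ (k + 1 + 1))) + w) := by
          rw [isUnit_iff_not_prime_dvd]
          intro hd'
          apply h2w
          convert dvd_sub hd' hd using 1
          ring
        exact Units.ext (sub_eq_zero.1 (hs.mul_left_eq_zero.1 hprod))
      · right
        have hs := (isUnit_iff_not_prime_dvd (k + 1) _).2 hd
        exact Units.ext (by simpa using eq_neg_of_add_eq_zero_left (hs.mul_right_eq_zero.1 hprod))
    · rintro (rfl | rfl) <;> simp
  have hne : w ≠ -w := by
    intro hw
    apply h2w
    have hw' := congrArg Units.val hw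
    rw [Units.val_neg] at hw'
    have : 2 * (w : ZMod (p ^ (k + 1 + 1))) = 0 := by linear_combination hw'
    rw [this]
    exact dvd_zero _
  rw [hfib, card_pair hne]
  norm_num

lemma kloostermanNearOne_add (k : ℕ) (w s : ZMod (p ^ (k + 1 + 1))) :
    kloostermanNearOne k (w + (p : ZMod (p ^ (k + 1 + 1))) ^ k * s) =
      ZMod.stdAddChar (2 * (p : ZMod (p ^ (k + 1 + 1))) ^ k * s) * kloostermanNearOne k w := by
  rw [kloostermanNearOne, kloostermanNearOne, mul_sum]
  refine sum_congr rfl fun x hx => ?_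
  obtain ⟨c, hc⟩ := (mem_filter.1 hx).2
  rw [← AddChar.map_add_eq_mul]
  congr 1
  have h0 := prime_pow_succ_eq_zero p (k + 1)
  have hxi := x.mul_inv
  rw [sub_eq_iff_eq_add] at hc
  set X' := ((x⁻¹ : (ZMod (p ^ (k + 1 + 1)))ˣ) : ZMod (p ^ (k + 1 + 1)))
  rw [hc] at hxi ⊢
  linear_combination s * c ^ 2 * X' * h0 -
    (p : ZMod (p ^ (k + 1 + 1))) ^ k * s * (p * c - 1) * hxi

lemma kloosterman_sq_pow (hodd : Odd p) (k n : ℕ) (w : (ZMod (p ^ (k + 1 + 1)))ˣ) :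
    kloosterman ((w : ZMod (p ^ (k + 1 + 1))) ^ 2) ^ n = ∑ m ∈ range (n + 1),
      kloostermanNearOne k (w : ZMod (p ^ (k + 1 + 1))) ^ m *
        kloostermanNearOne k (-(w : ZMod (p ^ (k + 1 + 1)))) ^ (n - m) * (n.choose m : ℂ) := by
  rw [kloosterman_sq hodd, add_pow]

lemma kloostermanNearOne_pow_mul_pow (k : ℕ) {m n : ℕ} (hm : m ≤ n)
    (w s : ZMod (p ^ (k + 1 + 1))) :
    kloostermanNearOne k (w + (p : ZMod (p ^ (k + 1 + 1))) ^ k * s) ^ m *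
        kloostermanNearOne k (-(w + (p : ZMod (p ^ (k + 1 + 1))) ^ k * s)) ^ (n - m) =
      kloostermanNearOne k w ^ m * kloostermanNearOne k (-w) ^ (n - m) *
        ZMod.stdAddChar ((p : ZMod (p ^ (k + 1 + 1))) ^ k *
          ((2 * (2 * m - n) : ℤ) : ZMod (p ^ (k + 1 + 1))) * s) := by
  have e1 : -(w + (p : ZMod (p ^ (k + 1 + 1))) ^ k * s) =
      -w + (p : ZMod (p ^ (k + 1 + 1))) ^ k * (-s) := by ring
  have e2 : (p : ZMod (p ^ (k + 1 + 1))) ^ k *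
        ((2 * (2 * m - n) : ℤ) : ZMod (p ^ (k + 1 + 1))) * s =
      m • (2 * (p : ZMod (p ^ (k + 1 + 1))) ^ k * s) +
        (n - m) • (2 * (p : ZMod (p ^ (k + 1 + 1))) ^ k * (-s)) := by
    simp only [nsmul_eq_mul, Nat.cast_sub hm]
    push_cast
    ring
  rw [e1, kloostermanNearOne_add, kloostermanNearOne_add, e2, AddChar.map_add_eq_mul,
    AddChar.map_nsmul_eq_pow, AddChar.map_nsmul_eq_pow]
  ring

/-- The odd power moments modulo `p ^ r` with `r ≥ 3` vanish. -/
lemma sum_kloosterman_pow_eq_zero (hodd : Odd p) {n : ℕ} (hn : Odd n) (hnp : n < p ^ 2) (k : ℕ)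
    (hk : k ≠ 0) : ∑ u : ZMod (p ^ (k + 1 + 1)), kloosterman u ^ n = 0 := by
  have hnil : IsNilpotent ((p : ZMod (p ^ (k + 1 + 1))) ^ k) :=
    IsNilpotent.pow_of_pos ⟨k + 1 + 1, prime_pow_succ_eq_zero p (k + 1)⟩ hk
  have h := sum_units_kloosterman_sq hodd k hn.pos.ne'
  have h0 : ∑ w : (ZMod (p ^ (k + 1 + 1)))ˣ,
      kloosterman ((w : ZMod (p ^ (k + 1 + 1))) ^ 2) ^ n = 0 := by
    simp_rw [kloosterman_sq_pow hodd]
    rw [sum_comm]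
    refine sum_eq_zero fun m hm => ?_
    replace hm : m ≤ n := Nat.lt_succ_iff.1 (mem_range.1 hm)
    rw [← sum_mul, sum_units_eq_sum_stationary hnil _
      (fun w => (p : ZMod (p ^ (k + 1 + 1))) ^ k *
        ((2 * (2 * m - n) : ℤ) : ZMod (p ^ (k + 1 + 1))) * w), filter_false_of_mem]
    · simp
    · intro w _ hw
      rw [w.isUnit.mul_left_eq_zero] at hw
      exact not_sq_dvd_two_mul hodd hn hnp hm ((prime_pow_mul_eq_zero_iff k 2 _).1 hw)
    · intro x y z hy
      have : (y : ZMod (p ^ (k + 1 + 1))) = x + (p : ZMod (p ^ (k + 1 + 1))) ^ k * (x * z) := by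
        rw [hy]
        ring
      rw [this, kloostermanNearOne_pow_mul_pow k hm]
      congr 2
      ring
  rw [h0] at h
  simpa using h.symm

lemma card_not_isUnit_prime_sq :
    #{x : ZMod (p ^ (0 + 1 + 1)) | ¬ IsUnit x} = p := by
  have h1 := card_filter_add_card_filter_not (s := (univ : Finset (ZMod (p ^ (0 + 1 + 1)))))
    (fun x => IsUnit x)
  have h2 : #{x : ZMod (p ^ (0 + 1 + 1)) | IsUnit x} = p * (p - 1) := by
    have h := sum_units_eq_sum_filter (fun _ : ZMod (p ^ (0 + 1 + 1)) => (1 : ℂ))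
    simp only [sum_const, nsmul_eq_mul, mul_one, card_univ, ZMod.card_units_eq_totient] at h
    rw [← Nat.cast_injective h, Nat.totient_prime_pow_succ hp.out]
    simp
  rw [h2, card_univ, ZMod.card] at h1
  obtain ⟨c, hc⟩ := Nat.exists_eq_succ_of_ne_zero hp.out.ne_zero
  subst hc
  simp only [Nat.succ_eq_add_one, Nat.add_sub_cancel] at h1 ⊢
  linarith [h1, show (c + 1) ^ (0 + 1 + 1) = (c + 1) * c + (c + 1) by ring]

lemma card_units_congr_one_prime_sq :
    #{x : (ZMod (p ^ (0 + 1 + 1)))ˣ |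
      (p : ZMod (p ^ (0 + 1 + 1))) ∣ (x : ZMod (p ^ (0 + 1 + 1))) - 1} = p := by
  conv_rhs => rw [← card_not_isUnit_prime_sq (p := p)]
  refine card_bij (fun x _ => (x : ZMod (p ^ (0 + 1 + 1))) - 1) ?_ ?_ ?_
  · intro x hx
    simp only [mem_filter, mem_univ, true_and, isUnit_iff_not_prime_dvd, not_not] at hx ⊢
    exact hx
  · intro x _ y _ h
    exact Units.ext (sub_left_injective h)
  · intro y hy
    simp only [mem_filter, mem_univ, true_and, isUnit_iff_not_prime_dvd, not_not] at hy
    have hu : IsUnit (y + 1) := by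
      rw [isUnit_iff_not_prime_dvd]
      intro h
      have := dvd_sub h hy
      rw [add_sub_cancel_left] at this
      exact not_prime_dvd_unit (0 + 1) 1 (by simpa using this)
    exact ⟨hu.unit, by simpa using hy, by simp⟩

lemma kloostermanNearOne_zero_prime_sq :
    kloostermanNearOne 0 (0 : ZMod (p ^ (0 + 1 + 1))) = p := by
  rw [kloostermanNearOne]
  simp only [zero_mul, AddChar.map_zero_eq_one, sum_const, nsmul_eq_mul, mul_one]
  rw [card_units_congr_one_prime_sq]

/-- Ramanujan's sum modulo `p ^ 2` at an integer not divisible by `p ^ 2`. -/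
lemma sum_units_stdAddChar_prime_sq {d : ℤ} (hd : ¬ (p : ℤ) ^ 2 ∣ d) :
    ∑ w : (ZMod (p ^ (0 + 1 + 1)))ˣ,
      (ZMod.stdAddChar ((d : ZMod (p ^ (0 + 1 + 1))) * (w : ZMod (p ^ (0 + 1 + 1)))) : ℂ) =
      if (p : ℤ) ∣ d then -(p : ℂ) else 0 := by
  have hd0 : (d : ZMod (p ^ (0 + 1 + 1))) ≠ 0 := by
    rw [Ne, ZMod.intCast_zmod_eq_zero_iff_dvd]
    simpa using hd
  split_ifs with hpd
  · have htot := sum_stdAddChar_mul (d : ZMod (p ^ (0 + 1 + 1)))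
    rw [if_neg hd0, ← sum_filter_add_sum_filter_not univ (fun x => IsUnit x),
      ← sum_units_eq_sum_filter
        (fun z => (ZMod.stdAddChar (z * (d : ZMod (p ^ (0 + 1 + 1)))) : ℂ))] at htot
    have hnon : ∑ x : ZMod (p ^ (0 + 1 + 1)) with ¬ IsUnit x,
        (ZMod.stdAddChar (x * (d : ZMod (p ^ (0 + 1 + 1)))) : ℂ) = p := by
      rw [sum_congr rfl (g := fun _ => 1)]
      · rw [sum_const, card_not_isUnit_prime_sq, nsmul_eq_mul, mul_one]
      · intro x hx
        have hx' := (mem_filter.1 hx).2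
        rw [isUnit_iff_not_prime_dvd, not_not] at hx'
        obtain ⟨c, rfl⟩ := hx'
        obtain ⟨e, rfl⟩ := hpd
        have h0 := prime_pow_succ_eq_zero p (0 + 1)
        have : (p * c * ((p * e : ℤ) : ZMod (p ^ (0 + 1 + 1))) : ZMod (p ^ (0 + 1 + 1))) = 0 := by
          push_cast
          linear_combination c * e * h0
        rw [this, AddChar.map_zero_eq_one]
    rw [hnon] at htot
    simp_rw [mul_comm (d : ZMod (p ^ (0 + 1 + 1)))]
    exact eq_neg_of_add_eq_zero_left htot
  · rw [sum_units_eq_sum_stationary (c := (p : ZMod (p ^ (0 + 1 + 1))))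
      ⟨0 + 1 + 1, prime_pow_succ_eq_zero p (0 + 1)⟩ _
      (fun w => (p : ZMod (p ^ (0 + 1 + 1))) * d * w), filter_false_of_mem]
    · simp
    · intro w _ hw
      rw [w.isUnit.mul_left_eq_zero] at hw
      have := prime_pow_mul_eq_zero_iff (p := p) 1 1 d
      simp only [pow_one] at this
      exact hpd (this.1 hw)
    · intro x y z hy
      rw [hy, ← AddChar.map_add_eq_mul]
      congr 1
      ring

lemma two_mul_sum_kloosterman_pow_prime_sq (hodd : Odd p) {n : ℕ} (hn : Odd n)
    (hnp : n < p ^ 2) :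
    2 * ∑ u : ZMod (p ^ (0 + 1 + 1)), kloosterman u ^ n =
      -(p : ℂ) ^ (n + 1) *
        ∑ m ∈ range (n + 1), (n.choose m : ℂ) * if (p : ℤ) ∣ 2 * m - n then 1 else 0 := by
  rw [← sum_units_kloosterman_sq hodd 0 hn.pos.ne']
  simp_rw [kloosterman_sq_pow hodd]
  rw [sum_comm, mul_sum]
  refine sum_congr rfl fun m hm => ?_
  replace hm : m ≤ n := Nat.lt_succ_iff.1 (mem_range.1 hm)
  have hterm (w : ZMod (p ^ (0 + 1 + 1))) :
      kloostermanNearOne 0 w ^ m * kloostermanNearOne 0 (-w) ^ (n - m) =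
        (p : ℂ) ^ n * ZMod.stdAddChar
          (((2 * (2 * m - n) : ℤ) : ZMod (p ^ (0 + 1 + 1))) * w) := by
    have h := kloostermanNearOne_pow_mul_pow (p := p) 0 hm 0 w
    simp only [pow_zero, one_mul, zero_add, neg_zero, kloostermanNearOne_zero_prime_sq] at h
    rw [h, ← pow_add, Nat.add_sub_cancel' hm]
  have hdvd : (p : ℤ) ∣ 2 * (2 * m - n) ↔ (p : ℤ) ∣ 2 * m - n := by
    have hcop : IsCoprime (p : ℤ) 2 := by
      exact_mod_cast Nat.isCoprime_iff_coprime.2 (Nat.coprime_two_right.2 hodd)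
    exact ⟨hcop.dvd_of_dvd_mul_left, fun h => h.mul_left 2⟩
  simp_rw [hterm]
  rw [← sum_mul, ← mul_sum,
    sum_units_stdAddChar_prime_sq (not_sq_dvd_two_mul hodd hn hnp hm)]
  simp only [hdvd]
  split_ifs <;> ring

end PrimePower

/-- For a weight `f` symmetric about its middle, applying Pascal's rule twice expresses the
weighted sum of row `m + 2` through row `m`. -/
lemma sum_choose_add_two_mul (m : ℕ) (f : ℕ → ℂ) (hf : ∀ i ≤ m, f (m - i) = f (i + 2)) :
    ∑ k ∈ range (m + 3), ((m + 2).choose k : ℂ) * f k =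
      2 * ∑ i ∈ range (m + 1), (m.choose i : ℂ) * (f (i + 1) + f (i + 2)) := by
  have hrefl : ∑ i ∈ range (m + 1), (m.choose i : ℂ) * f i =
      ∑ i ∈ range (m + 1), (m.choose i : ℂ) * f (i + 2) := by
    rw [← sum_range_reflect]
    refine sum_congr rfl fun i hi => ?_
    have hi' : i ≤ m := Nat.lt_succ_iff.1 (mem_range.1 hi)
    rw [Nat.add_sub_cancel, Nat.choose_symm hi', hf i hi']
  rw [sum_choose_succ_mul (fun i _ => f i) (m + 1), sum_choose_succ_mul (fun i _ => f i) m,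
    sum_choose_succ_mul (fun i _ => f (i + 1)) m, hrefl]
  simp only [mul_add, sum_add_distrib]
  ring

lemma mod_eq_mod_iff_int_dvd_sub (a b p : ℕ) : a % p = b % p ↔ (p : ℤ) ∣ (a : ℤ) - b :=
  Nat.modEq_iff_dvd.trans dvd_sub_comm

/-- Let `n ≥ 3` and `p` both be odd, `p` prime, with `p² > n`. Then `S_n(p^r) = 0` for
all `r ≥ 3`, and `S_n(p²) = −p^(n+1)·∑ C(n−2,i)`, the sum being over `0 ≤ i ≤ n−2`
with `2(i+1) ≡ n (mod p)` or `2(i+1) ≡ n−2 (mod p)`. -/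
theorem odd_moment_prime_square (n p : ℕ) (hn : 3 ≤ n) (hnodd : Odd n)
    (hp : p.Prime) (hpodd : Odd p) (hp2 : n < p ^ 2) :
    (∀ r : ℕ, 3 ≤ r → S n (p ^ r) = 0) ∧
    S n (p ^ 2) =
      -(p : ℂ) ^ (n + 1) *
        ∑ i ∈ (Finset.range (n - 1)).filter
            (fun i => 2 * (i + 1) % p = n % p ∨ 2 * (i + 1) % p = (n - 2) % p),
          (Nat.choose (n - 2) i : ℂ) := by
  have : Fact p.Prime := ⟨hp⟩
  constructor
  · intro r hr
    obtain ⟨k, rfl⟩ := Nat.exists_eq_add_of_le hr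
    have hk : 3 + k = (k + 1) + 1 + 1 := by omega
    rw [hk, S_eq_sum_kloosterman]
    exact sum_kloosterman_pow_eq_zero hpodd hnodd hp2 (k + 1) k.succ_ne_zero
  · obtain ⟨m, rfl⟩ : ∃ m, n = m + 2 := ⟨n - 2, by omega⟩
    have hS : S (m + 2) (p ^ 2) = S (m + 2) (p ^ (0 + 1 + 1)) := rfl
    have h := two_mul_sum_kloosterman_pow_prime_sq hpodd hnodd hp2
    rw [hS, S_eq_sum_kloosterman]
    apply mul_left_cancel₀ (two_ne_zero (α := ℂ))
    rw [h, sum_choose_add_two_mul m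
      (fun k => if (p : ℤ) ∣ 2 * k - (m + 2 : ℕ) then 1 else 0), mul_left_comm, sum_filter]
    · congr 2
      refine sum_congr (by congr 1) fun i _ => ?_
      simp only [mod_eq_mod_iff_int_dvd_sub, Nat.add_sub_cancel]
      have e1 : ((2 * (i + 1) : ℕ) : ℤ) - (m + 2 : ℕ) = 2 * (i + 1 : ℕ) - (m + 2 : ℕ) := by
        push_cast; ring
      have e2 : ((2 * (i + 1) : ℕ) : ℤ) - m = 2 * (i + 2 : ℕ) - (m + 2 : ℕ) := by
        push_cast; ring
      rw [e1, e2]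
      by_cases h1 : (p : ℤ) ∣ 2 * (i + 1 : ℕ) - (m + 2 : ℕ)
      · have h2 : ¬ (p : ℤ) ∣ 2 * (i + 2 : ℕ) - (m + 2 : ℕ) := by
          intro h2
          have h3 := dvd_sub h2 h1
          have e3 : (2 * (i + 2 : ℕ) - (m + 2 : ℕ) - (2 * (i + 1 : ℕ) - (m + 2 : ℕ)) : ℤ)
              = (2 : ℕ) := by push_cast; ring
          rw [e3, Int.natCast_dvd_natCast, Nat.prime_dvd_prime_iff_eq hp Nat.prime_two] at h3
          subst h3
          exact absurd hpodd (by decide)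
        simp only [h1, h2, or_false, if_true, if_false, add_zero, mul_one]
      · simp only [h1, false_or, if_false, zero_add, mul_ite, mul_one, mul_zero]
    · intro i hi
      have e : (2 * ((m - i : ℕ) : ℤ) - (m + 2 : ℕ)) = -(2 * (i + 2 : ℕ) - (m + 2 : ℕ)) := by
        push_cast [hi]
        ring
      simp only [e, dvd_neg]
end

section
/- Let n ≥ 3 and p both be odd, with n an integer, p a prime, and p² > n. Let N(n,p) denote the number of tuples (x_1,…,x_{n−1}) ∈ ((ℤ/pℤ)^*)^{n−1} satisfying (x_1+⋯+x_{n−1})·(x_1^{−1}+⋯+x_{n−1}^{−1}) ≡ 1 (mod p) and, for each 1 ≤ i ≤ n−1, (x_1^{−1}+⋯+x_{n−1}^{−1}) − (x_1+⋯+x_{n−1})·x_i^{−2} ≡ 0 (mod p). Then N(n,p) = (p−1)·Σ C(n−2, i), where the sum runs over all integers i with 0 ≤ i ≤ n−2 such that 2(i+1) ≡ n (mod p) or 2(i+1) ≡ n−2 (mod p), and moreover V_n(p²) = p^{n−2}·(V_n(p) − N(n,p)). -/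
open Finset

/-- `N(n,p)`: the number of singular toric solutions modulo `p` of the Laurent
polynomial `g = (x_1+⋯+x_{n-1})(x_1⁻¹+⋯+x_{n-1}⁻¹) − 1`. -/
noncomputable def N (n p : ℕ) : ℕ :=
  Nat.card {x : Fin (n - 1) → (ZMod p)ˣ //
    (∑ i, ((x i : ZMod p))) * (∑ i, (((x i)⁻¹ : (ZMod p)ˣ) : ZMod p)) = 1 ∧
    ∀ i, (∑ j, (((x j)⁻¹ : (ZMod p)ˣ) : ZMod p))
        - (∑ j, ((x j : ZMod p))) * (((x i)⁻¹ : (ZMod p)ˣ) : ZMod p) ^ 2 = 0}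

/-- `π` is a ring homomorphism whose kernel is the square-zero ideal `j F`, with `j` an
injective map that is linear over `π`. -/
structure IsSquareZeroExtension {R F : Type*} [CommRing R] [CommRing F]
    (π : R →+* F) (j : F →+ R) : Prop where
  injective : Function.Injective j
  mul_eq_zero : ∀ a b, j a * j b = 0
  mul_apply : ∀ r a, r * j a = j (π r * a)
  exists_eq : ∀ r, π r = 0 → ∃ a, j a = r
  map_apply : ∀ a, π (j a) = 0

theorem exists_isSquareZeroExtension (p : ℕ) [NeZero p] :
    ∃ j : ZMod p →+ ZMod (p ^ 2),
      IsSquareZeroExtension (ZMod.castHom (dvd_pow_self p two_ne_zero) (ZMod p)) j := by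
  have hp0 : (p : ℤ) ≠ 0 := by exact_mod_cast NeZero.ne p
  let f : ℤ →+ ZMod (p ^ 2) :=
    (AddMonoidHom.mulLeft (p : ZMod (p ^ 2))).comp (Int.castAddHom (ZMod (p ^ 2)))
  have hpp : (p : ZMod (p ^ 2)) * p = 0 := by
    rw [← sq]; exact_mod_cast ZMod.natCast_self (p ^ 2)
  have hf : f p = 0 := by simpa [f] using hpp
  have hj (a : ℤ) : ZMod.lift p ⟨f, hf⟩ (a : ZMod p) = (p : ZMod (p ^ 2)) * a := by
    rw [ZMod.lift_coe]; simp [f]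
  refine ⟨ZMod.lift p ⟨f, hf⟩, ?_, ?_, ?_, ?_, ?_⟩
  · rw [injective_iff_map_eq_zero]
    intro a ha
    obtain ⟨a, rfl⟩ := ZMod.intCast_surjective a
    rw [hj] at ha
    have h1 : (((p * a : ℤ)) : ZMod (p ^ 2)) = 0 := by exact_mod_cast ha
    rw [ZMod.intCast_zmod_eq_zero_iff_dvd] at h1 ⊢
    push_cast at h1
    rw [sq] at h1
    exact Int.dvd_of_mul_dvd_mul_left hp0 h1
  · intro a b
    obtain ⟨a, rfl⟩ := ZMod.intCast_surjective a
    obtain ⟨b, rfl⟩ := ZMod.intCast_surjective b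
    rw [hj, hj]
    linear_combination (a * b : ZMod (p ^ 2)) * hpp
  · intro r a
    obtain ⟨a, rfl⟩ := ZMod.intCast_surjective a
    obtain ⟨r, rfl⟩ := ZMod.intCast_surjective r
    rw [hj, show ZMod.castHom (dvd_pow_self p two_ne_zero) (ZMod p) (r : ZMod (p ^ 2)) = r from
      map_intCast _ _, (Int.cast_mul r a).symm, hj]
    push_cast
    ring
  · intro r hr
    obtain ⟨r, rfl⟩ := ZMod.intCast_surjective r
    rw [map_intCast, ZMod.intCast_zmod_eq_zero_iff_dvd] at hr
    obtain ⟨k, rfl⟩ := hr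
    exact ⟨k, by rw [hj]; push_cast; rfl⟩
  · intro a
    obtain ⟨a, rfl⟩ := ZMod.intCast_surjective a
    rw [hj, map_mul, map_natCast]
    simp

/-- The value of the Laurent polynomial `(∑ x i) * (∑ (x i)⁻¹)` at a tuple of units. -/
def toricProd {ι R : Type*} [Fintype ι] [CommRing R] (x : ι → Rˣ) : R :=
  (∑ i, (x i : R)) * ∑ i, (((x i)⁻¹ : Rˣ) : R)

/-- The logarithmic gradient `x i * ∂ᵢ` of `toricProd`. -/
def toricGrad {ι R : Type*} [Fintype ι] [CommRing R] (x : ι → Rˣ) (i : ι) : R :=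
  (x i : R) * (∑ k, (((x k)⁻¹ : Rˣ) : R)) - (∑ k, (x k : R)) * (((x i)⁻¹ : Rˣ) : R)

theorem map_toricProd {ι R F : Type*} [Fintype ι] [CommRing R] [CommRing F] (π : R →+* F)
    (x : ι → Rˣ) : π (toricProd x) = toricProd fun i => Units.map π.toMonoidHom (x i) := by
  simp [toricProd, map_sum, ← map_inv]

namespace IsSquareZeroExtension

variable {ι R F : Type*} [Fintype ι] [CommRing R] [CommRing F] {π : R →+* F} {j : F →+ R}

/-- The unit `1 + j a`. -/
def unit (h : IsSquareZeroExtension π j) (a : F) : Rˣ where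
  val := 1 + j a
  inv := 1 - j a
  val_inv := by linear_combination -h.mul_eq_zero a a
  inv_val := by linear_combination -h.mul_eq_zero a a

theorem map_unit (h : IsSquareZeroExtension π j) (a : F) :
    Units.map π.toMonoidHom (h.unit a) = 1 := by
  ext; simp [unit, h.map_apply]

theorem unit_injective (h : IsSquareZeroExtension π j) : Function.Injective h.unit := by
  intro a b hab
  apply h.injective
  simpa [unit] using congrArg Units.val hab

theorem exists_unit_eq (h : IsSquareZeroExtension π j) (u : Rˣ)
    (hu : Units.map π.toMonoidHom u = 1) : ∃ a, h.unit a = u := by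
  obtain ⟨a, ha⟩ := h.exists_eq ((u : R) - 1) (by
    have := congrArg Units.val hu
    simp at this
    simp [this])
  exact ⟨a, by ext; simp [unit, ha]⟩

theorem toricProd_mul_unit (h : IsSquareZeroExtension π j) (x : ι → Rˣ) (t : ι → F) :
    toricProd (fun i => x i * h.unit (t i)) = toricProd x +
      j (∑ i, toricGrad (fun i => Units.map π.toMonoidHom (x i)) i * t i) := by
  have h1 : ∑ i, ((x i * h.unit (t i) : Rˣ) : R) = ∑ i, (x i : R) + j (∑ i, π (x i) * t i) := by
    simp [unit, mul_add, h.mul_apply, Finset.sum_add_distrib, map_sum]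
  have h2 : ∑ i, (((x i * h.unit (t i))⁻¹ : Rˣ) : R) =
      ∑ i, (((x i)⁻¹ : Rˣ) : R) - j (∑ i, π ((x i)⁻¹ : Rˣ) * t i) := by
    have (i : ι) : (((x i * h.unit (t i))⁻¹ : Rˣ) : R) =
        (((x i)⁻¹ : Rˣ) : R) - j (π ((x i)⁻¹ : Rˣ) * t i) := by
      rw [mul_inv, Units.val_mul, ← h.mul_apply]
      simp only [unit, Units.inv_mk, Units.val_mk]
      ring
    simp only [this, Finset.sum_sub_distrib, map_sum]
  have h3 : ∑ i, toricGrad (fun i => Units.map π.toMonoidHom (x i)) i * t i =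
      π (∑ i, (((x i)⁻¹ : Rˣ) : R)) * (∑ i, π (x i) * t i) -
        π (∑ i, (x i : R)) * (∑ i, π ((x i)⁻¹ : Rˣ) * t i) := by
    rw [Finset.mul_sum, Finset.mul_sum, ← Finset.sum_sub_distrib]
    refine Finset.sum_congr rfl fun i _ => ?_
    simp only [toricGrad, ← map_inv, Units.coe_map, map_sum]
    simp
    ring
  rw [toricProd, h1, h2, h3, map_sub, ← h.mul_apply, ← h.mul_apply, toricProd]
  linear_combination -h.mul_eq_zero (∑ i, π (x i) * t i) (∑ i, π ((x i)⁻¹ : Rˣ) * t i)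

/-- Parametrization of the fibre of reduction through a given tuple. -/
noncomputable def fiberEquiv (h : IsSquareZeroExtension π j) (x : ι → Rˣ) :
    (ι → F) ≃ {z : ι → Rˣ // (fun i => Units.map π.toMonoidHom (z i)) =
      fun i => Units.map π.toMonoidHom (x i)} :=
  Equiv.ofBijective (fun t => ⟨fun i => x i * h.unit (t i), by
    funext i; rw [map_mul, h.map_unit, mul_one]⟩) (by
    constructor
    · intro s t hst
      funext i
      have := congrFun (congrArg Subtype.val hst) i
      exact h.unit_injective (mul_left_cancel this)
    · rintro ⟨z, hz⟩
      have (i : ι) : ∃ a, h.unit a = (x i)⁻¹ * z i :=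
        h.exists_unit_eq _ (by rw [map_mul, map_inv, congrFun hz i, inv_mul_cancel])
      choose t ht using this
      exact ⟨t, by simp [ht]⟩)

end IsSquareZeroExtension

theorem card_linear_fiber {ι F : Type*} [Fintype ι] [Field F] [Finite F]
    (a : ι → F) (ha : a ≠ 0) (c : F) :
    Nat.card {t : ι → F // ∑ i, a i * t i = c} = Nat.card F ^ (Fintype.card ι - 1) := by
  classical
  cases nonempty_fintype F
  let L : (ι → F) →+ F :=
    { toFun := fun t => ∑ i, a i * t i
      map_zero' := by simp
      map_add' := fun s t => by simp [mul_add, Finset.sum_add_distrib] }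
  have hL : Function.Surjective L := by
    obtain ⟨i, hi⟩ := Function.ne_iff.mp ha
    simp only [Pi.zero_apply] at hi
    intro b
    refine ⟨Pi.single i ((a i)⁻¹ * b), ?_⟩
    simp [L, Pi.single_apply, hi]
  have hι : Fintype.card ι ≠ 0 := by
    obtain ⟨i, hi⟩ := Function.ne_iff.mp ha
    exact (Fintype.card_pos_iff.mpr ⟨i⟩).ne'
  have h1 : Fintype.card (ι → F) = ∑ b : F, (Finset.univ.filter fun t => L t = b).card :=
    Finset.card_eq_sum_card_fiberwise (by simp)
  have h2 (b : F) : (Finset.univ.filter fun t => L t = b).card =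
      (Finset.univ.filter fun t => L t = c).card :=
    AddMonoidHom.card_fiber_eq_of_mem_range L (hL b) (hL c)
  simp only [h2, Finset.sum_const, Finset.card_univ, smul_eq_mul, Fintype.card_fun] at h1
  have h3 : Nat.card {t : ι → F // ∑ i, a i * t i = c} =
      (Finset.univ.filter fun t => L t = c).card := by
    rw [Nat.card_eq_fintype_card, Fintype.card_subtype]; rfl
  rw [h3, Nat.card_eq_fintype_card]
  apply Nat.eq_of_mul_eq_mul_left (Fintype.card_pos (α := F))
  rw [← h1, ← pow_succ', Nat.sub_add_cancel (Nat.one_le_iff_ne_zero.mpr hι)]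

theorem IsSquareZeroExtension.card_fiber {ι R F : Type*} [Fintype ι] [CommRing R] [Field F]
    [Finite F] {π : R →+* F} {j : F →+ R} (h : IsSquareZeroExtension π j) (x : ι → Rˣ)
    (hx : toricProd (fun i => Units.map π.toMonoidHom (x i)) = 1)
    (hgrad : toricGrad (fun i => Units.map π.toMonoidHom (x i)) ≠ 0) :
    Nat.card {z : ι → Rˣ // (fun i => Units.map π.toMonoidHom (z i)) =
      (fun i => Units.map π.toMonoidHom (x i)) ∧ toricProd z = 1} =
      Nat.card F ^ (Fintype.card ι - 1) := by
  obtain ⟨c, hc⟩ := h.exists_eq (1 - toricProd x) (by rw [map_sub, map_toricProd, hx]; simp)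
  rw [← card_linear_fiber _ hgrad c]
  refine (Nat.card_congr ?_).symm
  refine (Equiv.subtypeEquiv (h.fiberEquiv x) ?_).trans
    (Equiv.subtypeSubtypeEquivSubtypeInter _ fun z => toricProd z = 1)
  intro t
  change _ ↔ toricProd (fun i => x i * h.unit (t i)) = 1
  rw [h.toricProd_mul_unit, ← eq_sub_iff_add_eq', ← hc, h.injective.eq_iff]

/-- The tuple equal to `u` on `s` and to `-u` off `s`. -/
def signTuple {ι R : Type*} [DecidableEq ι] [CommRing R] (u : Rˣ) (s : Finset ι) (i : ι) : Rˣ :=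
  if i ∈ s then u else -u

theorem signTuple_inv {ι R : Type*} [DecidableEq ι] [CommRing R] (u : Rˣ) (s : Finset ι) (i : ι) :
    (signTuple u s i)⁻¹ = signTuple u⁻¹ s i := by
  by_cases hi : i ∈ s <;> simp [signTuple, hi]

section SignTuple

variable {ι R : Type*} [Fintype ι] [DecidableEq ι] [CommRing R]

theorem sum_signTuple (u : Rˣ) (s : Finset ι) :
    ∑ i, (signTuple u s i : R) = u * (2 * s.card - Fintype.card ι) := by
  have (i : ι) : (signTuple u s i : R) = (if i ∈ s then 2 * (u : R) else 0) - u := by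
    by_cases hi : i ∈ s <;> simp [signTuple, hi]
    ring
  simp only [this, Finset.sum_sub_distrib, Finset.sum_ite_mem, Finset.univ_inter,
    Finset.sum_const, Finset.card_univ, nsmul_eq_mul]
  ring

theorem toricProd_signTuple (u : Rˣ) (s : Finset ι) :
    toricProd (signTuple u s) = (2 * s.card - Fintype.card ι : R) ^ 2 := by
  rw [toricProd, sum_signTuple]
  simp only [signTuple_inv, sum_signTuple]
  linear_combination (2 * s.card - Fintype.card ι : R) ^ 2 * u.mul_inv

theorem toricGrad_signTuple (u : Rˣ) (s : Finset ι) : toricGrad (signTuple u s) = 0 := by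
  funext i
  simp only [toricGrad, signTuple_inv, sum_signTuple]
  by_cases hi : i ∈ s <;> simp only [signTuple, hi, if_true, if_false, Units.val_neg, Pi.zero_apply]
    <;> ring

end SignTuple

theorem exists_signTuple_eq {ι F : Type*} [Fintype ι] [DecidableEq ι] [Field F] {x : ι → Fˣ}
    (hx : toricProd x = 1) (hgrad : toricGrad x = 0) :
    ∃ (u : Fˣ) (s : Finset ι), (2 * s.card : F) = Fintype.card ι + 1 ∧ signTuple u s = x := by
  classical
  have hS : ∑ i, (x i : F) ≠ 0 := left_ne_zero_of_mul_eq_one hx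
  set u : Fˣ := Units.mk0 _ hS with hu
  have hval : (u : F) = ∑ i, (x i : F) := rfl
  have hpm (i : ι) : x i = u ∨ x i = -u := by
    have h1 := congrFun hgrad i
    simp only [toricGrad, Pi.zero_apply] at h1
    rw [toricProd] at hx
    rw [← hval] at h1 hx
    have h2 : (x i : F) ^ 2 = (u : F) ^ 2 := by
      have h3 := (x i).mul_inv
      linear_combination (u : F) * x i * h1 - (x i : F) ^ 2 * hx + (u : F) ^ 2 * h3
    rcases sq_eq_sq_iff_eq_or_eq_neg.mp h2 with h | h
    · exact Or.inl (Units.ext h)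
    · exact Or.inr (Units.ext (by simpa using h))
  have hsign : signTuple u (Finset.univ.filter fun i => x i = u) = x := by
    funext i
    by_cases hi : x i = u
    · simp [signTuple, hi]
    · rw [signTuple, if_neg (by simpa using hi), (hpm i).resolve_left hi]
  refine ⟨u, _, ?_, hsign⟩
  have h := sum_signTuple u (Finset.univ.filter fun i => x i = u)
  rw [hsign, ← hval] at h
  have := mul_left_cancel₀ u.ne_zero ((mul_one (u : F)).trans h)
  linear_combination -this

theorem card_singular {ι F : Type*} [Fintype ι] [DecidableEq ι] [Field F] [Finite F]
    (h2 : (2 : F) ≠ 0) :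
    Nat.card {x : ι → Fˣ // toricProd x = 1 ∧ toricGrad x = 0} =
      Nat.card Fˣ * Nat.card {s : Finset ι // (2 * s.card : F) = Fintype.card ι + 1} := by
  rw [← Nat.card_prod]
  refine (Nat.card_congr (Equiv.ofBijective
    (fun us => ⟨signTuple us.1 us.2.1, by
      rw [toricProd_signTuple, us.2.2]; ring, toricGrad_signTuple _ _⟩) ⟨?_, ?_⟩)).symm
  · rintro ⟨u, s, hs⟩ ⟨v, t, ht⟩ hst
    have hst : signTuple u s = signTuple v t := congrArg Subtype.val hst
    have huv : u = v := by
      have h1 := sum_signTuple u s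
      have h2 := sum_signTuple v t
      rw [hst, h2, hs, ht] at h1
      ext
      linear_combination -h1
    subst huv
    have hne : u ≠ -u := by
      intro h
      have h := congrArg Units.val h
      rw [Units.val_neg] at h
      exact mul_ne_zero h2 u.ne_zero (by linear_combination h)
    have : s = t := by
      ext i
      have h := congrFun hst i
      by_cases hi : i ∈ s <;> by_cases hi' : i ∈ t <;> simp_all [signTuple]
    subst this
    rfl
  · rintro ⟨x, hx, hgrad⟩
    obtain ⟨u, s, hs, rfl⟩ := exists_signTuple_eq hx hgrad
    exact ⟨⟨u, s, hs⟩, rfl⟩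

theorem IsSquareZeroExtension.toricProd_eq_of_toricGrad_eq_zero {ι R F : Type*} [Fintype ι]
    [CommRing R] [CommRing F] {π : R →+* F} {j : F →+ R} (h : IsSquareZeroExtension π j)
    {x z : ι → Rˣ} (hz : (fun i => Units.map π.toMonoidHom (z i)) =
      fun i => Units.map π.toMonoidHom (x i))
    (hgrad : toricGrad (fun i => Units.map π.toMonoidHom (x i)) = 0) :
    toricProd z = toricProd x := by
  obtain ⟨t, ht⟩ := (h.fiberEquiv x).surjective ⟨z, hz⟩
  have ht : (fun i => x i * h.unit (t i)) = z := congrArg Subtype.val ht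
  rw [← ht, h.toricProd_mul_unit, hgrad]
  simp

theorem toricProd_signTuple_ne_one {ι : Type*} [Fintype ι] [DecidableEq ι] {p : ℕ}
    (hp : p.Prime) (hpodd : Odd p) (hι : Even (Fintype.card ι)) (hcard : Fintype.card ι + 1 < p ^ 2)
    (u : (ZMod (p ^ 2))ˣ) (s : Finset ι) (hs : (2 * s.card : ZMod p) = Fintype.card ι + 1) :
    toricProd (signTuple u s) ≠ 1 := by
  intro h
  rw [toricProd_signTuple] at h
  set m := Fintype.card ι with hm
  have hsm : s.card ≤ m := Finset.card_le_univ s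
  have h1 : (p : ℤ) ∣ 2 * s.card - m - 1 := by
    rw [← ZMod.intCast_zmod_eq_zero_iff_dvd]
    push_cast
    linear_combination hs
  have h2 : ((p : ℤ) ^ 2) ∣ (2 * s.card - m - 1) * (2 * s.card - m + 1) := by
    have : ((p : ℤ) ^ 2) = ((p ^ 2 : ℕ) : ℤ) := by push_cast; rfl
    rw [this, ← ZMod.intCast_zmod_eq_zero_iff_dvd]
    push_cast
    linear_combination h
  have h3 : IsCoprime ((p : ℤ) ^ 2) (2 * s.card - m + 1) := by
    apply IsCoprime.pow_left
    rw [(Nat.prime_iff_prime_int.mp hp).coprime_iff_not_dvd]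
    intro h4
    have h5 := dvd_sub h4 h1
    ring_nf at h5
    have h6 : p ∣ 2 := by exact_mod_cast h5
    have := (Nat.prime_dvd_prime_iff_eq hp Nat.prime_two).mp h6
    subst this
    exact absurd hpodd (by decide)
  have h4 := Int.eq_zero_of_abs_lt_dvd (h3.dvd_of_dvd_mul_right h2) (by
    rw [abs_lt]
    have : ((m : ℤ) + 1) < (p : ℤ) ^ 2 := by exact_mod_cast hcard
    constructor <;> linarith [(by exact_mod_cast hsm : (s.card : ℤ) ≤ m), (Int.natCast_nonneg s.card)])
  obtain ⟨k, hk⟩ := hι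
  omega

theorem card_toricProd_lift {ι : Type*} [Fintype ι] [DecidableEq ι] {p : ℕ} [Fact p.Prime]
    (hpodd : Odd p) (hι : Even (Fintype.card ι)) (hcard : Fintype.card ι + 1 < p ^ 2) :
    Nat.card {x : ι → (ZMod (p ^ 2))ˣ // toricProd x = 1} =
      Nat.card {x : ι → (ZMod p)ˣ // toricProd x = 1 ∧ toricGrad x ≠ 0} *
        p ^ (Fintype.card ι - 1) := by
  classical
  have hp : p.Prime := Fact.out
  obtain ⟨j, h⟩ := exists_isSquareZeroExtension p
  set π := ZMod.castHom (dvd_pow_self p two_ne_zero) (ZMod p) with hπ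
  let red : (ι → (ZMod (p ^ 2))ˣ) → ι → (ZMod p)ˣ := fun x i => Units.map π.toMonoidHom (x i)
  have hsurj : Function.Surjective (Units.map π.toMonoidHom) :=
    ZMod.unitsMap_surjective (dvd_pow_self p two_ne_zero)
  have hmaps : Set.MapsTo red
      (Finset.univ.filter fun x : ι → (ZMod (p ^ 2))ˣ => toricProd x = 1)
      (Finset.univ.filter fun x : ι → (ZMod p)ˣ => toricProd x = 1 ∧ toricGrad x ≠ 0) := by
    intro z hz
    simp only [Finset.coe_filter, Finset.mem_univ, true_and, Set.mem_ofPred_eq] at hz ⊢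
    have hred : toricProd (red z) = 1 := by rw [← map_toricProd, hz, map_one]
    refine ⟨hred, fun hgrad => ?_⟩
    obtain ⟨u, s, hs, hus⟩ := exists_signTuple_eq hred hgrad
    obtain ⟨v, rfl⟩ := hsurj u
    have hv : red z = red (signTuple v s) := by
      rw [← hus]
      funext i
      by_cases hi : i ∈ s
      · simp [red, signTuple, hi]
      · ext; simp [red, signTuple, hi]
    refine toricProd_signTuple_ne_one hp hpodd hι hcard v s hs ?_
    rw [← hz]
    refine (h.toricProd_eq_of_toricGrad_eq_zero hv ?_).symm
    change toricGrad (red _) = 0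
    rw [← hv, hgrad]
  rw [Nat.card_eq_fintype_card, Nat.card_eq_fintype_card, Fintype.card_subtype,
    Fintype.card_subtype, Finset.card_eq_sum_card_fiberwise hmaps]
  refine Finset.sum_const_nat fun y hy => ?_
  simp only [Finset.mem_filter, Finset.mem_univ, true_and] at hy
  obtain ⟨x, rfl⟩ : ∃ x, red x = y := by
    choose x hx using fun i => hsurj (y i)
    exact ⟨x, funext hx⟩
  have := h.card_fiber x hy.1 hy.2
  rw [Nat.card_zmod, Nat.card_eq_fintype_card, Fintype.card_subtype] at this
  rw [← this, Finset.filter_filter]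
  congr 1
  ext z
  simp only [Finset.mem_filter, Finset.mem_univ, true_and]
  exact and_comm

theorem two_ne_zero_of_odd_prime {p : ℕ} (hp : p.Prime) (hpodd : Odd p) : (2 : ZMod p) ≠ 0 := by
  have : ((2 : ℕ) : ZMod p) ≠ 0 := by
    rw [Ne, ZMod.natCast_eq_zero_iff]
    intro h
    have := (Nat.prime_dvd_prime_iff_eq hp Nat.prime_two).mp h
    subst this
    exact absurd hpodd (by decide)
  exact_mod_cast this

theorem card_finset_two_mul_card (M p : ℕ) (hp : p.Prime) (hpodd : Odd p):
    Nat.card {s : Finset (Fin (M + 1)) //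
        (2 * s.card : ZMod p) = Fintype.card (Fin (M + 1)) + 1} =
      ∑ i ∈ (Finset.range (M + 1)).filter
        (fun i => 2 * (i + 1) % p = (M + 2) % p ∨ 2 * (i + 1) % p = M % p), M.choose i := by
  classical
  let f : ℕ → ℕ := fun k => if (2 * k : ZMod p) = M + 2 then 1 else 0
  have h1 : Nat.card {s : Finset (Fin (M + 1)) //
        (2 * s.card : ZMod p) = Fintype.card (Fin (M + 1)) + 1} =
      ∑ k ∈ Finset.range (M + 1 + 1), (M + 1).choose k * f k := by
    have := Finset.sum_powerset_apply_card f (x := (Finset.univ : Finset (Fin (M + 1))))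
    simp only [Finset.card_univ, Fintype.card_fin, smul_eq_mul, Finset.powerset_univ] at this
    rw [← this, Nat.card_eq_fintype_card, Fintype.card_subtype, Finset.card_filter]
    refine Finset.sum_congr rfl fun s _ => ?_
    simp only [f, Fintype.card_fin]
    congr 1
    push_cast
    rw [add_assoc, one_add_one_eq_two]
  have h3 : ∑ k ∈ Finset.range (M + 1 + 1), (M + 1).choose k * f k =
      ∑ k ∈ Finset.range (M + 1), M.choose k * f (k + 1) +
        ∑ k ∈ Finset.range (M + 1), M.choose k * f k := by
    rw [Finset.sum_range_succ']
    simp only [Nat.choose_succ_succ, add_mul, Finset.sum_add_distrib]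
    rw [add_assoc]
    congr 1
    rw [Finset.sum_range_succ' (fun k => M.choose k * f k) M, Finset.sum_range_succ]
    simp
  have h4 : ∑ k ∈ Finset.range (M + 1), M.choose k * f k =
      ∑ k ∈ Finset.range (M + 1), M.choose k * f (M - k) := by
    rw [← Finset.sum_range_reflect]
    refine Finset.sum_congr rfl fun k hk => ?_
    have hk : k ≤ M := Nat.lt_succ_iff.mp (Finset.mem_range.mp hk)
    rw [Nat.add_sub_cancel, Nat.choose_symm hk]
  rw [h1, h3, h4, ← Finset.sum_add_distrib, Finset.sum_filter]
  refine Finset.sum_congr rfl fun k hk => ?_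
  have hk : k ≤ M := Nat.lt_succ_iff.mp (Finset.mem_range.mp hk)
  have e1 : (2 * (k + 1) % p = (M + 2) % p) ↔ (2 * ((k + 1 : ℕ) : ZMod p) = M + 2) := by
    rw [← ZMod.natCast_eq_natCast_iff']
    push_cast
    rfl
  have e2 : (2 * (k + 1) % p = M % p) ↔ (2 * ((M - k : ℕ) : ZMod p) = M + 2) := by
    rw [← ZMod.natCast_eq_natCast_iff', Nat.cast_sub hk]
    push_cast
    constructor <;> intro h <;> linear_combination -h
  have hdisj : ¬ ((2 * (k + 1) % p = (M + 2) % p) ∧ (2 * (k + 1) % p = M % p)) := by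
    rw [← ZMod.natCast_eq_natCast_iff', ← ZMod.natCast_eq_natCast_iff']
    rintro ⟨ha, hb⟩
    push_cast at ha hb
    exact two_ne_zero_of_odd_prime hp hpodd (by linear_combination hb - ha)
  simp only [f]
  rw [← mul_add]
  simp only [e1, e2] at hdisj ⊢
  split_ifs <;> simp_all

theorem N_eq_card (n p : ℕ) [Fact p.Prime] :
    N n p = Nat.card {x : Fin (n - 1) → (ZMod p)ˣ // toricProd x = 1 ∧ toricGrad x = 0} := by
  refine Nat.card_congr (Equiv.subtypeEquivRight fun x => and_congr_right fun _ => ?_)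
  rw [funext_iff]
  refine forall_congr' fun i => ?_
  have h : toricGrad x i = (x i : ZMod p) * ((∑ j, (((x j)⁻¹ : (ZMod p)ˣ) : ZMod p))
        - (∑ j, ((x j : ZMod p))) * (((x i)⁻¹ : (ZMod p)ˣ) : ZMod p) ^ 2) := by
    rw [toricGrad]
    linear_combination (∑ j, ((x j : ZMod p))) * (((x i)⁻¹ : (ZMod p)ˣ) : ZMod p) * (x i).mul_inv
  rw [h, Pi.zero_apply, Units.mul_right_eq_zero]

/-- Let `n ≥ 3` and `p` both be odd, `p` prime, with `p² > n`. Then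
`N(n,p) = (p−1)·∑ C(n−2,i)` (sum over `0 ≤ i ≤ n−2` with `2(i+1) ≡ n` or
`≡ n−2 (mod p)`), and `V_n(p²) = p^(n−2)·(V_n(p) − N(n,p))`. -/
theorem singular_count_and_V (n p : ℕ) (hn : 3 ≤ n) (hnodd : Odd n)
    (hp : p.Prime) (hpodd : Odd p) (hp2 : n < p ^ 2) :
    N n p = (p - 1) *
        ∑ i ∈ (Finset.range (n - 1)).filter
            (fun i => 2 * (i + 1) % p = n % p ∨ 2 * (i + 1) % p = (n - 2) % p),
          Nat.choose (n - 2) i ∧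
    (V n (p ^ 2) : ℤ) = (p : ℤ) ^ (n - 2) * ((V n p : ℤ) - (N n p : ℤ)) := by
  have : Fact p.Prime := ⟨hp⟩
  obtain ⟨M, rfl⟩ : ∃ M, n = M + 2 := ⟨n - 2, by omega⟩
  refine ⟨?_, ?_⟩
  · rw [N_eq_card]
    change Nat.card {x : Fin (M + 1) → (ZMod p)ˣ // toricProd x = 1 ∧ toricGrad x = 0} = _
    rw [card_singular (two_ne_zero_of_odd_prime hp hpodd), card_finset_two_mul_card M p hp hpodd,
      Nat.card_eq_fintype_card, ZMod.card_units]
    rfl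
  · have hV : V (M + 2) p = N (M + 2) p +
        Nat.card {x : Fin (M + 1) → (ZMod p)ˣ // toricProd x = 1 ∧ toricGrad x ≠ 0} := by
      classical
      rw [N_eq_card, V]
      change Nat.card {x : Fin (M + 1) → (ZMod p)ˣ // toricProd x = 1} =
        Nat.card {x : Fin (M + 1) → (ZMod p)ˣ // toricProd x = 1 ∧ toricGrad x = 0} + _
      simp only [Nat.card_eq_fintype_card, Fintype.card_subtype, ← Finset.filter_filter]
      exact (Finset.card_filter_add_card_filter_not _).symm
    have hlift := card_toricProd_lift (ι := Fin (M + 1)) hpodd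
      (by rw [Fintype.card_fin]; rcases hnodd with ⟨k, hk⟩; exact ⟨k, by omega⟩)
      (by simpa using hp2)
    change V (M + 2) (p ^ 2) = _ at hlift
    rw [hlift, hV]
    simp
    ring
end
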